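/- arXiv:2106.01660 — 6 statements merged into one kernel-verified Lean document; each statement's English description precedes it below -/
import Mathlib

section
/- Let A_1, …, A_n ∈ ℝ^d be fixed vectors whose span has dimension k, let η_1, …, η_n be independent standard Gaussian random variables, let θ⋆ ∈ Θ where Θ ⊆ B^d_1, set X_t = ⟨A_t, θ⋆⟩² + η_t, and let θ̂ minimize L(θ) = (1/2) Σ_{t=1}^n (X_t − ⟨A_t, θ⟩²)² over Θ. Then for any δ ∈ (0,1), the probability that Σ_{t=1}^n ⟨A_t, θ̂ − θ⋆⟩² · ⟨A_t, θ̂ + θ⋆⟩² ≥ 9·(log(1/δ) + k·log(98n)) is at most δ. -/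
open MeasureTheory ProbabilityTheory
open scoped RealInnerProductSpace

section GaussianTails

variable {E : Type*} [NormedAddCommGroup E] [InnerProductSpace ℝ E] [FiniteDimensional ℝ E]
  [MeasurableSpace E] [BorelSpace E]

lemma stdGaussian_real_inner_ge_le {u : E} (hu : u ≠ 0) {c : ℝ} (hc : 0 ≤ c) :
    (stdGaussian E).real {z | c * ‖u‖ ≤ ⟪u, z⟫} ≤ Real.exp (-c ^ 2 / 2) := by
  have hu' : 0 < ‖u‖ := norm_pos_iff.mpr hu
  have hmap : (stdGaussian E).map (fun z => ⟪u, z⟫) =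
      gaussianReal 0 (Real.toNNReal (‖u‖ ^ 2)) := by
    have h := IsGaussian.map_eq_gaussianReal (μ := stdGaussian E) (innerSL ℝ u)
    rw [integral_strongDual_stdGaussian, variance_dual_stdGaussian, innerSL_apply_norm] at h
    exact h
  have hmgf := mgf_gaussianReal hmap (c / ‖u‖)
  have hint : Integrable (fun z => Real.exp (c / ‖u‖ * ⟪u, z⟫)) (stdGaussian E) := by
    refine Integrable.of_integral_ne_zero ?_
    rw [mgf] at hmgf
    rw [hmgf]
    positivity
  refine (measure_ge_le_exp_mul_mgf (c * ‖u‖) (by positivity : 0 ≤ c / ‖u‖) hint).trans ?_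
  rw [hmgf, ← Real.exp_add, Real.coe_toNNReal _ (by positivity)]
  apply le_of_eq
  congr 1
  field_simp
  ring

lemma stdGaussian_map_orthogonalProjection (W : Submodule ℝ E) :
    (stdGaussian E).map W.orthogonalProjectionOnto = stdGaussian W := by
  apply Measure.ext_of_charFunDual
  ext L
  rw [charFunDual_map, charFunDual_stdGaussian, charFunDual_stdGaussian]
  suffices h : ‖L.comp W.orthogonalProjectionOnto‖ = ‖L‖ by rw [h]
  apply le_antisymm
  · refine (ContinuousLinearMap.opNorm_comp_le _ _).trans ?_
    exact mul_le_of_le_one_right (norm_nonneg _) W.orthogonalProjectionOnto_norm_le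
  · refine ContinuousLinearMap.opNorm_le_bound _ (norm_nonneg _) fun w => ?_
    have := (L.comp W.orthogonalProjectionOnto).le_opNorm (w : E)
    simpa using this

lemma integral_exp_sq_gaussianReal :
    ∫ x, Real.exp (4 / 9 * x ^ 2) ∂(gaussianReal 0 1) = 3 := by
  rw [integral_gaussianReal_eq_integral_smul one_ne_zero]
  have h : ∀ x : ℝ, gaussianPDFReal 0 1 x • Real.exp (4 / 9 * x ^ 2) =
      (√(2 * Real.pi))⁻¹ * Real.exp (-(1 / 18) * x ^ 2) := by
    intro x
    simp only [gaussianPDFReal, NNReal.coe_one, smul_eq_mul, mul_one, sub_zero]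
    rw [mul_assoc, ← Real.exp_add]
    ring_nf
  simp_rw [h]
  rw [integral_const_mul, integral_gaussian, inv_mul_eq_div, ← Real.sqrt_div' _ (by positivity)]
  have : Real.pi / (1 / 18) / (2 * Real.pi) = 3 ^ 2 := by
    field_simp
    norm_num
  rw [this]
  exact Real.sqrt_sq (by norm_num)

lemma integral_exp_norm_sq_stdGaussian :
    ∫ z, Real.exp (4 / 9 * ‖z‖ ^ 2) ∂(stdGaussian E) = 3 ^ Module.finrank ℝ E := by
  let b := stdOrthonormalBasis ℝ E
  rw [stdGaussian_eq_map_pi_orthonormalBasis b, integral_map (Measurable.aemeasurable (by fun_prop))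
    (by fun_prop)]
  have h : ∀ x : Fin (Module.finrank ℝ E) → ℝ, Real.exp (4 / 9 * ‖∑ i, x i • b i‖ ^ 2) =
      ∏ i, Real.exp (4 / 9 * x i ^ 2) := by
    intro x
    rw [← Real.exp_sum, ← Finset.mul_sum, ← b.sum_sq_norm_inner_right]
    congr 3
    ext i
    rw [b.orthonormal.inner_right_fintype, Real.norm_eq_abs, sq_abs]
  simp_rw [h]
  rw [integral_fintype_prod_eq_pow (fun x : ℝ => Real.exp (4 / 9 * x ^ 2)),
    integral_exp_sq_gaussianReal, Fintype.card_fin]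

lemma stdGaussian_real_norm_orthogonalProjection_ge_le (W : Submodule ℝ E) (x : ℝ) :
    (stdGaussian E).real {z | x ≤ ‖W.orthogonalProjectionOnto z‖ ^ 2} ≤
      3 ^ Module.finrank ℝ W * Real.exp (-(4 / 9) * x) := by
  have hmeas : MeasurableSet {w : W | x ≤ ‖w‖ ^ 2} :=
    measurableSet_le measurable_const (by fun_prop)
  have hset : {z : E | x ≤ ‖W.orthogonalProjectionOnto z‖ ^ 2} =
      W.orthogonalProjectionOnto ⁻¹' {w : W | x ≤ ‖w‖ ^ 2} := rfl
  rw [hset, ← map_measureReal_apply (by fun_prop) hmeas, stdGaussian_map_orthogonalProjection,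
    mul_comm]
  have hI := integral_exp_norm_sq_stdGaussian (E := W)
  have hint : Integrable (fun w : W => Real.exp (4 / 9 * ‖w‖ ^ 2)) (stdGaussian W) := by
    refine Integrable.of_integral_ne_zero ?_
    rw [hI]
    positivity
  have := measure_ge_le_exp_mul_mgf (X := fun w : W => ‖w‖ ^ 2) x (by norm_num : (0 : ℝ) ≤ 4 / 9)
    hint
  rwa [mgf, hI] at this

end GaussianTails

section Covering

variable {α F : Type*} [NormedAddCommGroup F] [NormedSpace ℝ F] [FiniteDimensional ℝ F]

lemma card_le_of_separated_of_diam_le {φ : α → F} {s : Finset α} {ε : ℝ} (hε : 0 < ε)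
    (hdiam : ∀ c ∈ s, ∀ d ∈ s, ‖φ c - φ d‖ ≤ 2)
    (hsep : ∀ c ∈ s, ∀ d ∈ s, c ≠ d → ε < ‖φ c - φ d‖) :
    (s.card : ℝ) ≤ (1 + 4 / ε) ^ Module.finrank ℝ F := by
  rcases s.eq_empty_or_nonempty with rfl | ⟨c₀, hc₀⟩
  · simp only [Finset.card_empty, Nat.cast_zero]
    positivity
  borelize F
  let μ : Measure F := Measure.addHaar
  have hdisj : (s : Set α).Pairwise
      (Function.onFun Disjoint fun c => Metric.ball (φ c) (ε / 2)) := by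
    intro c hc d hd hcd
    apply Metric.ball_disjoint_ball
    rw [dist_eq_norm]
    linarith [hsep c hc d hd hcd]
  have hsub : (⋃ c ∈ s, Metric.ball (φ c) (ε / 2)) ⊆ Metric.ball (φ c₀) (2 + ε / 2) := by
    refine Set.iUnion₂_subset fun c hc => Metric.ball_subset_ball' ?_
    rw [dist_eq_norm]
    linarith [hdiam c hc c₀ hc₀]
  have hvol : (s.card : ENNReal) * ENNReal.ofReal ((ε / 2) ^ Module.finrank ℝ F) *
      μ (Metric.ball 0 1) ≤
      ENNReal.ofReal ((2 + ε / 2) ^ Module.finrank ℝ F) * μ (Metric.ball 0 1) := by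
    calc _ = μ (⋃ c ∈ s, Metric.ball (φ c) (ε / 2)) := by
          rw [measure_biUnion_finset hdisj fun c _ => measurableSet_ball]
          simp only [μ.addHaar_ball_of_pos _ (half_pos hε), Finset.sum_const, nsmul_eq_mul,
            mul_assoc]
      _ ≤ _ := measure_mono hsub
      _ = _ := μ.addHaar_ball_of_pos _ (by positivity)
  have hvol' := (ENNReal.mul_le_mul_iff_left (Metric.measure_ball_pos _ _ zero_lt_one).ne'
    measure_ball_lt_top.ne).1 hvol
  have hreal := ENNReal.toReal_le_of_le_ofReal (by positivity) hvol'
  rw [ENNReal.toReal_mul, ENNReal.toReal_natCast, ENNReal.toReal_ofReal (by positivity),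
    ← le_div_iff₀ (by positivity), ← div_pow] at hreal
  have heq : (2 + ε / 2) / (ε / 2) = 1 + 4 / ε := by
    field_simp
    ring
  rwa [heq] at hreal

lemma exists_finset_cover_of_diam_le (φ : α → F) {X : Set α} {ε : ℝ} (hε : 0 < ε)
    (hdiam : ∀ x ∈ X, ∀ y ∈ X, ‖φ x - φ y‖ ≤ 2) :
    ∃ N : Finset α, (N : Set α) ⊆ X ∧ (N.card : ℝ) ≤ (1 + 4 / ε) ^ Module.finrank ℝ F ∧
      ∀ x ∈ X, ∃ y ∈ N, ‖φ x - φ y‖ ≤ ε := by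
  classical
  let P : ℕ → Prop := fun m => ∃ s : Finset α, (s : Set α) ⊆ X ∧
    (∀ c ∈ s, ∀ d ∈ s, c ≠ d → ε < ‖φ c - φ d‖) ∧ s.card = m
  have hcard : ∀ s : Finset α, (s : Set α) ⊆ X →
      (∀ c ∈ s, ∀ d ∈ s, c ≠ d → ε < ‖φ c - φ d‖) →
      (s.card : ℝ) ≤ (1 + 4 / ε) ^ Module.finrank ℝ F := fun s hs hsep =>
    card_le_of_separated_of_diam_le hε (fun c hc d hd => hdiam c (hs hc) d (hs hd)) hsep
  have hbound : ∀ m, P m → m ≤ ⌊(1 + 4 / ε) ^ Module.finrank ℝ F⌋₊ := by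
    rintro m ⟨s, hs, hsep, rfl⟩
    exact Nat.le_floor (hcard s hs hsep)
  have hP0 : P 0 := ⟨∅, by simp, by simp, rfl⟩
  obtain ⟨s, hs, hsep, hsm⟩ := Nat.findGreatest_spec (hbound 0 hP0) hP0
  refine ⟨s, hs, hcard s hs hsep, fun x hx => ?_⟩
  by_contra! hfar
  have hxs : x ∉ s := fun hxs => by
    have := hfar x hxs
    simp only [sub_self, norm_zero] at this
    exact absurd this hε.not_gt
  have hP : P (s.card + 1) := by
    refine ⟨insert x s, ?_, ?_, Finset.card_insert_of_notMem hxs⟩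
    · rw [Finset.coe_insert]
      exact Set.insert_subset hx hs
    · intro c hc d hd hcd
      rcases Finset.mem_insert.mp hc with rfl | hcs
      · rcases Finset.mem_insert.mp hd with rfl | hds
        · exact absurd rfl hcd
        · exact hfar d hds
      · rcases Finset.mem_insert.mp hd with rfl | hds
        · rw [norm_sub_rev]
          exact hfar c hcs
        · exact hsep c hcs d hds hcd
  have := Nat.le_findGreatest (hbound _ hP) hP
  omega

end Covering

section SignPatterns

variable {ι : Type*} [Fintype ι]

/-- The sets of coordinates on which the elements of a subspace of `ι → ℝ` are nonnegative. -/
noncomputable def signPatterns (V : Submodule ℝ (ι → ℝ)) : Finset (Finset ι) := by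
  classical
  exact Finset.univ.filter fun s => ∃ x ∈ V, s = Finset.univ.filter fun t => 0 ≤ x t

lemma mem_signPatterns {V : Submodule ℝ (ι → ℝ)} {x : ι → ℝ} (hx : x ∈ V) :
    (Finset.univ.filter fun t => 0 ≤ x t) ∈ signPatterns V := by
  classical
  simp only [signPatterns, Finset.mem_filter, Finset.mem_univ, true_and]
  exact ⟨x, hx, by congr⟩

lemma card_le_finrank_of_shatters [DecidableEq ι] {V : Submodule ℝ (ι → ℝ)} {S : Finset ι}
    (hS : (signPatterns V).Shatters S) : S.card ≤ Module.finrank ℝ V := by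
  by_contra! hlt
  let res : (ι → ℝ) →ₗ[ℝ] (S → ℝ) := LinearMap.funLeft ℝ ℝ (fun t : S => (t : ι))
  have hne : V.map res ≠ ⊤ := by
    intro h
    have h1 := Submodule.finrank_map_le res V
    rw [h, finrank_top, Module.finrank_fintype_fun_eq_card, Fintype.card_coe] at h1
    omega
  obtain ⟨f, hf0, hf⟩ := Submodule.exists_le_ker_of_lt_top _ hne.lt_top
  have hrep : ∀ y : S → ℝ, f y = ∑ t, y t * f (Pi.single t 1) := fun y => by
    rw [LinearMap.pi_apply_eq_sum_univ f y]
    refine Finset.sum_congr rfl fun t _ => ?_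
    rw [smul_eq_mul]
    congr 2
    funext j
    simp [Pi.single_apply, eq_comm]
  -- up to replacing `f` by `-f`, some coefficient of `f` is positive
  obtain ⟨g, hg, t₀, ht₀⟩ : ∃ g : S → ℝ, (∀ x ∈ V, ∑ t : S, x t * g t = 0) ∧ ∃ t₀, 0 < g t₀ := by
    have hker : ∀ x ∈ V, ∑ t : S, x t * f (Pi.single t 1) = 0 := fun x hx => by
      have := hf (Submodule.mem_map_of_mem (f := res) hx)
      rw [LinearMap.mem_ker, hrep] at this
      exact this
    obtain ⟨t₀, ht₀⟩ : ∃ t₀, f (Pi.single t₀ 1) ≠ 0 := by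
      by_contra! h
      exact hf0 (LinearMap.ext fun y => by rw [hrep]; simp [h])
    rcases lt_or_gt_of_ne ht₀ with h | h
    · refine ⟨fun t => -f (Pi.single t 1), fun x hx => ?_, t₀, by simpa using h⟩
      simp only [mul_neg, Finset.sum_neg_distrib, hker x hx, neg_zero]
    · exact ⟨fun t => f (Pi.single t 1), hker, t₀, h⟩
  obtain ⟨u, hu, hSu⟩ := hS (Finset.filter_subset (fun t => ∀ h : t ∈ S, g ⟨t, h⟩ ≤ 0) S)
  simp only [signPatterns, Finset.mem_filter, Finset.mem_univ, true_and] at hu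
  obtain ⟨x, hx, rfl⟩ := hu
  have hsign : ∀ t : S, 0 ≤ x t ↔ g t ≤ 0 := fun t => by
    have := Finset.ext_iff.mp hSu t
    simpa [t.2] using this
  have hlt : ∑ t : S, x t * g t < 0 := by
    refine Finset.sum_neg' (fun t _ => ?_) ⟨t₀, Finset.mem_univ _, ?_⟩
    · rcases le_or_gt (g t) 0 with h | h
      · exact mul_nonpos_of_nonneg_of_nonpos ((hsign t).2 h) h
      · exact mul_nonpos_of_nonpos_of_nonneg
          (le_of_not_ge fun h' => absurd ((hsign t).1 h') h.not_ge) h.le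
    · exact mul_neg_of_neg_of_pos
        (lt_of_not_ge fun h' => absurd ((hsign t₀).1 h') ht₀.not_ge) ht₀
  exact absurd (hg x hx) hlt.ne

lemma sum_choose_le_exp_mul_div_pow {n k : ℕ} (hk : 1 ≤ k) (hkn : k ≤ n) :
    (∑ i ∈ Finset.Iic k, (n.choose i : ℝ)) ≤ (Real.exp 1 * n / k) ^ k := by
  have hk' : (0 : ℝ) < k := by exact_mod_cast hk
  have hkn' : (k : ℝ) ≤ n := by exact_mod_cast hkn
  have hn' : (0 : ℝ) < n := hk'.trans_le hkn'
  have hq : (k : ℝ) / n ≤ 1 := (div_le_one hn').2 hkn'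
  have hmain : (∑ i ∈ Finset.Iic k, (n.choose i : ℝ)) * ((k : ℝ) / n) ^ k ≤ Real.exp 1 ^ k := by
    calc (∑ i ∈ Finset.Iic k, (n.choose i : ℝ)) * ((k : ℝ) / n) ^ k
        ≤ ∑ i ∈ Finset.Iic k, ((k : ℝ) / n) ^ i * (n.choose i : ℝ) := by
          rw [Finset.sum_mul]
          refine Finset.sum_le_sum fun i hi => ?_
          rw [mul_comm]
          exact mul_le_mul_of_nonneg_right
            (pow_le_pow_of_le_one (by positivity) hq (Finset.mem_Iic.1 hi)) (by positivity)
      _ ≤ ∑ i ∈ Finset.range (n + 1), ((k : ℝ) / n) ^ i * (n.choose i : ℝ) := by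
          refine Finset.sum_le_sum_of_subset_of_nonneg (fun i hi => ?_) fun _ _ _ => by positivity
          rw [Finset.mem_Iic] at hi
          rw [Finset.mem_range]
          omega
      _ = ((k : ℝ) / n + 1) ^ n := by
          rw [add_pow]
          simp
      _ ≤ Real.exp ((k : ℝ) / n) ^ n := by
          gcongr
          exact Real.add_one_le_exp _
      _ = Real.exp 1 ^ k := by
          rw [← Real.exp_nat_mul, ← Real.exp_nat_mul]
          congr 1
          field_simp
  have : (Real.exp 1 * n / k) ^ k = Real.exp 1 ^ k / ((k : ℝ) / n) ^ k := by
    rw [← div_pow]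
    congr 1
    field_simp
  rw [this, le_div_iff₀ (by positivity)]
  exact hmain

lemma card_signPatterns_le {V : Submodule ℝ (ι → ℝ)} {k : ℕ} (hV : Module.finrank ℝ V ≤ k)
    (hk : 1 ≤ k) (hkn : k ≤ Fintype.card ι) :
    ((signPatterns V).card : ℝ) ≤ (Real.exp 1 * Fintype.card ι / k) ^ k := by
  classical
  refine le_trans ?_ (sum_choose_le_exp_mul_div_pow hk hkn)
  have hvc : (signPatterns V).vcDim ≤ k := Finset.sup_le fun S hS =>
    (card_le_finrank_of_shatters (Finset.mem_shatterer.1 hS)).trans hV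
  have h := ((signPatterns V).card_le_card_shatterer.trans
    Finset.card_shatterer_le_sum_vcDim).trans
    (Finset.sum_le_sum_of_subset (Finset.Iic_subset_Iic.2 hvc))
  exact_mod_cast h

end SignPatterns

section SquareNet

variable {ι : Type*} [Fintype ι]

/-- The coordinatewise square of a vector, as an element of Euclidean space. -/
noncomputable def sqVec (x : ι → ℝ) : EuclideanSpace ℝ ι := WithLp.toLp 2 fun t => x t ^ 2

lemma norm_sqVec_sub_sq (x y : ι → ℝ) :
    ‖sqVec x - sqVec y‖ ^ 2 = ∑ t, (x t ^ 2 - y t ^ 2) ^ 2 := by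
  rw [EuclideanSpace.real_norm_sq_eq]
  rfl

lemma sq_sub_le_abs_sq_sub_sq {a b : ℝ} (hab : 0 ≤ a * b) : (a - b) ^ 2 ≤ |a ^ 2 - b ^ 2| := by
  rcases le_total (a ^ 2) (b ^ 2) with h | h
  · rw [abs_of_nonpos (by linarith)]
    nlinarith [abs_le_of_sq_le_sq' (sq_abs b ▸ h) (abs_nonneg b), abs_mul_abs_self a,
      abs_mul_abs_self b, abs_mul a b, abs_of_nonneg hab, abs_nonneg a, abs_nonneg b,
      sq_le_sq.mp h]
  · rw [abs_of_nonneg (by linarith)]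
    nlinarith [abs_mul_abs_self a,
      abs_mul_abs_self b, abs_mul a b, abs_of_nonneg hab, abs_nonneg a, abs_nonneg b,
      sq_le_sq.mp h]

lemma abs_abs_sub_abs_mul_abs_le (a p : ℝ) : |(|a| - |p|)| * |p| ≤ |a ^ 2 - p ^ 2| := by
  have : a ^ 2 - p ^ 2 = (|a| - |p|) * (|a| + |p|) := by
    rw [← sq_abs a, ← sq_abs p]
    ring
  rw [this, abs_mul, abs_of_nonneg (by positivity : 0 ≤ |a| + |p|)]
  gcongr
  linarith [abs_nonneg a]

lemma abs_sub_mul_le {a b p : ℝ} (hab : 0 ≤ a * b) :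
    |(a - b) * p| ≤ |a ^ 2 - p ^ 2| + |b ^ 2 - p ^ 2| := by
  have hdiff : |a - b| = |(|a| - |b|)| := by
    rw [← sq_eq_sq₀ (abs_nonneg _) (abs_nonneg _), sq_abs, sq_abs, sub_sq, sub_sq, sq_abs, sq_abs,
      mul_assoc, mul_assoc, ← abs_mul, abs_of_nonneg hab]
  have htri : |(|a| - |b|)| ≤ |(|a| - |p|)| + |(|b| - |p|)| := by
    rw [abs_sub_comm |b| |p|]
    exact abs_sub_le _ _ _
  rw [abs_mul, hdiff]
  nlinarith [abs_abs_sub_abs_mul_abs_le a p, abs_abs_sub_abs_mul_abs_le b p, abs_nonneg p]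

lemma sum_sub_pow_four_le {x y s : ι → ℝ} {ρ : ℝ} (hsign : ∀ t, 0 ≤ x t * y t)
    (hx : ‖sqVec x - sqVec s‖ ≤ ρ) (hy : ‖sqVec y - sqVec s‖ ≤ ρ) :
    ∑ t, (x t - y t) ^ 4 ≤ (2 * ρ) ^ 2 := by
  have h : ‖sqVec x - sqVec y‖ ≤ 2 * ρ := by
    rw [← sub_sub_sub_cancel_right _ _ (sqVec s)]
    linarith [norm_sub_le (sqVec x - sqVec s) (sqVec y - sqVec s)]
  refine le_trans ?_ (pow_le_pow_left₀ (norm_nonneg _) h 2)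
  rw [norm_sqVec_sub_sq]
  refine Finset.sum_le_sum fun t _ => ?_
  rw [← sq_abs (x t ^ 2 - y t ^ 2), show (x t - y t) ^ 4 = ((x t - y t) ^ 2) ^ 2 by ring]
  exact pow_le_pow_left₀ (sq_nonneg _) (sq_sub_le_abs_sq_sub_sq (hsign t)) 2

lemma sum_sub_mul_sq_le {x y s : ι → ℝ} {ρ : ℝ} (hsign : ∀ t, 0 ≤ x t * y t)
    (hx : ‖sqVec x - sqVec s‖ ≤ ρ) (hy : ‖sqVec y - sqVec s‖ ≤ ρ) :
    ∑ t, ((x t - y t) * s t) ^ 2 ≤ (2 * ρ) ^ 2 := by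
  have hle : ∀ t, ((x t - y t) * s t) ^ 2 ≤
      2 * (x t ^ 2 - s t ^ 2) ^ 2 + 2 * (y t ^ 2 - s t ^ 2) ^ 2 := fun t => by
    have h := abs_sub_mul_le (p := s t) (hsign t)
    rw [← sq_abs ((x t - y t) * s t), ← sq_abs (x t ^ 2 - s t ^ 2),
      ← sq_abs (y t ^ 2 - s t ^ 2)]
    nlinarith [pow_le_pow_left₀ (abs_nonneg _) h 2,
      sq_nonneg (|x t ^ 2 - s t ^ 2| - |y t ^ 2 - s t ^ 2|)]
  refine (Finset.sum_le_sum fun t _ => hle t).trans ?_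
  rw [Finset.sum_add_distrib, ← Finset.mul_sum, ← Finset.mul_sum, ← norm_sqVec_sub_sq,
    ← norm_sqVec_sub_sq]
  nlinarith [pow_le_pow_left₀ (norm_nonneg _) hx 2, pow_le_pow_left₀ (norm_nonneg _) hy 2]

lemma norm_sqVec_sub_le {x y s : ι → ℝ} {ρ ε : ℝ} (hρ : 0 ≤ ρ) (hε : 0 ≤ ε)
    (hy : ‖sqVec y - sqVec s‖ ≤ ρ)
    (h4 : ∑ t, (x t - y t) ^ 4 ≤ (ε ^ 2 * ρ / 2) ^ 2)
    (h2 : ∑ t, ((x t - y t) * s t) ^ 2 ≤ (ε * ρ) ^ 2) :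
    ‖sqVec x - sqVec y‖ ≤ ρ * (2.45 * ε + ε ^ 2 / 2) := by
  let h : ι → ℝ := x - y
  let a : EuclideanSpace ℝ ι := WithLp.toLp 2 fun t => h t * y t
  let q : EuclideanSpace ℝ ι := WithLp.toLp 2 fun t => h t ^ 2
  have hq : ‖q‖ ≤ ε ^ 2 * ρ / 2 := by
    refine le_of_sq_le_sq ?_ (by positivity)
    rw [EuclideanSpace.real_norm_sq_eq]
    refine le_trans (le_of_eq ?_) h4
    refine Finset.sum_congr rfl fun t _ => ?_
    simp only [q, h, Pi.sub_apply]
    ring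
  have ha : ‖a‖ ≤ 1.225 * (ε * ρ) := by
    refine le_of_sq_le_sq ?_ (by positivity)
    have hinner : ⟪q, sqVec y - sqVec s⟫ = ∑ t, h t ^ 2 * (y t ^ 2 - s t ^ 2) := by
      rw [PiLp.inner_apply]
      refine Finset.sum_congr rfl fun t _ => ?_
      simp [q, sqVec, mul_comm]
    have hcs := (real_inner_le_norm q (sqVec y - sqVec s)).trans
      (mul_le_mul hq hy (norm_nonneg _) (by positivity))
    have hsum : ‖a‖ ^ 2 = ∑ t, (h t * s t) ^ 2 + ⟪q, sqVec y - sqVec s⟫ := by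
      rw [EuclideanSpace.real_norm_sq_eq, hinner, ← Finset.sum_add_distrib]
      refine Finset.sum_congr rfl fun t _ => ?_
      simp only [a]
      ring
    have h2' : ∑ t, (h t * s t) ^ 2 ≤ (ε * ρ) ^ 2 := h2
    rw [hsum]
    nlinarith [sq_nonneg (ε * ρ)]
  have hsplit : sqVec x - sqVec y = (2 : ℝ) • a + q := by
    ext t
    simp only [sqVec, a, q, h, Pi.sub_apply, PiLp.sub_apply, PiLp.add_apply, PiLp.smul_apply,
      smul_eq_mul]
    ring
  rw [hsplit]
  refine (norm_add_le _ _).trans ?_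
  rw [norm_smul, Real.norm_ofNat]
  linarith

lemma norm_toLp_four_pow [Fact ((1 : ENNReal) ≤ 4)] (h : ι → ℝ) :
    ‖(WithLp.toLp 4 h : PiLp 4 fun _ : ι => ℝ)‖ ^ 4 = ∑ t, h t ^ 4 := by
  have h4 : (4 : ENNReal).toReal = 4 := by simp
  rw [PiLp.norm_eq_sum (by simp), h4]
  have hn : 0 ≤ ∑ t, ‖h t‖ ^ (4 : ℝ) := Finset.sum_nonneg fun _ _ => by positivity
  rw [← Real.rpow_natCast, ← Real.rpow_mul hn]
  norm_num
  refine Finset.sum_congr rfl fun t _ => ?_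
  exact_mod_cast (even_two_mul 2).pow_abs (h t)

/-- The vectors of a subspace whose coordinatewise squares are close to that of `s` and whose
sign patterns agree have a small net, when distances are measured after squaring. -/
lemma exists_net_of_sign {V : Submodule ℝ (ι → ℝ)} {k : ℕ} (hV : Module.finrank ℝ V ≤ k)
    (s : ι → ℝ) {ρ ε : ℝ} (hρ : 0 < ρ) (hε : 0 < ε) (X : Set V)
    (hX : ∀ x ∈ X, ‖sqVec (x : ι → ℝ) - sqVec s‖ ≤ ρ)
    (hsign : ∀ x ∈ X, ∀ y ∈ X, ∀ t, 0 ≤ (x : ι → ℝ) t * (y : ι → ℝ) t) :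
    ∃ N : Finset V, (N : Set V) ⊆ X ∧ (N.card : ℝ) ≤ (1 + 4 / ε) ^ k ∧
      ∀ x ∈ X, ∃ y ∈ N,
        ‖sqVec (x : ι → ℝ) - sqVec (y : ι → ℝ)‖ ≤ ρ * (2.45 * ε + ε ^ 2 / 2) := by
  have : Fact ((1 : ENNReal) ≤ 4) := ⟨by norm_num⟩
  let Φ₁ : (ι → ℝ) →ₗ[ℝ] PiLp 4 fun _ : ι => ℝ :=
    (√2 / √ρ) • (WithLp.linearEquiv 4 ℝ (ι → ℝ)).symm.toLinearMap
  let Φ₂ : (ι → ℝ) →ₗ[ℝ] EuclideanSpace ℝ ι :=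
    (1 / ρ) • (WithLp.linearEquiv 2 ℝ (ι → ℝ)).symm.toLinearMap ∘ₗ LinearMap.mulRight ℝ s
  let Ψ := (Φ₁.prod Φ₂) ∘ₗ V.subtype
  have hn₁ : ∀ h r, 0 ≤ r → (‖Φ₁ h‖ ≤ r ↔ ∑ t, h t ^ 4 ≤ (r ^ 2 * ρ / 2) ^ 2) := by
    intro h r hr
    have : ‖Φ₁ h‖ ^ 4 = 4 / ρ ^ 2 * ∑ t, h t ^ 4 := by
      rw [← norm_toLp_four_pow]
      simp only [Φ₁, LinearMap.smul_apply, norm_smul]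
      rw [mul_pow, Real.norm_of_nonneg (by positivity), div_pow,
        show √2 ^ 4 = (√2 ^ 2) ^ 2 by ring, show √ρ ^ 4 = (√ρ ^ 2) ^ 2 by ring,
        Real.sq_sqrt (by norm_num), Real.sq_sqrt hρ.le]
      norm_num
    rw [← pow_le_pow_iff_left₀ (norm_nonneg _) hr (by norm_num : 4 ≠ 0), this, div_mul_eq_mul_div,
      div_le_iff₀ (by positivity)]
    constructor <;> intro h <;> nlinarith
  have hn₂ : ∀ h r, 0 ≤ r → (‖Φ₂ h‖ ≤ r ↔ ∑ t, (h t * s t) ^ 2 ≤ (r * ρ) ^ 2) := by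
    intro h r hr
    have : ‖Φ₂ h‖ ^ 2 = 1 / ρ ^ 2 * ∑ t, (h t * s t) ^ 2 := by
      simp only [Φ₂, LinearMap.smul_apply, norm_smul]
      rw [mul_pow, Real.norm_of_nonneg (by positivity), div_pow, one_pow,
        EuclideanSpace.real_norm_sq_eq]
      rfl
    rw [← pow_le_pow_iff_left₀ (norm_nonneg _) hr (by norm_num : 2 ≠ 0), this, div_mul_eq_mul_div,
      div_le_iff₀ (by positivity), one_mul, mul_pow]
  have hΨ : ∀ (x y : V) r, 0 ≤ r → (‖Ψ.rangeRestrict x - Ψ.rangeRestrict y‖ ≤ r ↔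
      ∑ t, ((x : ι → ℝ) t - (y : ι → ℝ) t) ^ 4 ≤ (r ^ 2 * ρ / 2) ^ 2 ∧
        ∑ t, (((x : ι → ℝ) t - (y : ι → ℝ) t) * s t) ^ 2 ≤ (r * ρ) ^ 2) := by
    intro x y r hr
    rw [← map_sub]
    change ‖(Φ₁ (x - y : ι → ℝ), Φ₂ (x - y : ι → ℝ))‖ ≤ r ↔ _
    rw [Prod.norm_mk, max_le_iff, hn₁ _ _ hr, hn₂ _ _ hr]
    rfl
  obtain ⟨N, hNX, hcard, hN⟩ := exists_finset_cover_of_diam_le Ψ.rangeRestrict hε (X := X)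
    fun x hx y hy => (hΨ x y 2 zero_le_two).2
      ⟨by
        have := sum_sub_pow_four_le (hsign x hx y hy) (hX x hx) (hX y hy)
        convert this using 2
        ring, sum_sub_mul_sq_le (hsign x hx y hy) (hX x hx) (hX y hy)⟩
  refine ⟨N, hNX, hcard.trans ?_, fun x hx => ?_⟩
  · refine pow_le_pow_right₀ ?_ ((LinearMap.finrank_range_le Ψ).trans hV)
    linarith [div_pos four_pos hε]
  · obtain ⟨y, hy, hxy⟩ := hN x hx
    have := (hΨ x y ε hε.le).1 hxy
    exact ⟨y, hy, norm_sqVec_sub_le hρ.le hε.le (hX y (hNX hy)) this.1 this.2⟩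

lemma exists_net {V : Submodule ℝ (ι → ℝ)} {k : ℕ} (hV : Module.finrank ℝ V ≤ k)
    (hk : 1 ≤ k) (hkn : k ≤ Fintype.card ι) (s : ι → ℝ) {ρ ε : ℝ} (hρ : 0 < ρ) (hε : 0 < ε)
    (X : Set V) (hX : ∀ x ∈ X, ‖sqVec (x : ι → ℝ) - sqVec s‖ ≤ ρ) :
    ∃ N : Finset V, (N : Set V) ⊆ X ∧
      (N.card : ℝ) ≤ (Real.exp 1 * Fintype.card ι / k * (1 + 4 / ε)) ^ k ∧
      ∀ x ∈ X, ∃ y ∈ N,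
        ‖sqVec (x : ι → ℝ) - sqVec (y : ι → ℝ)‖ ≤ ρ * (2.45 * ε + ε ^ 2 / 2) := by
  classical
  let σ : V → Finset ι := fun x => Finset.univ.filter fun t => 0 ≤ (x : ι → ℝ) t
  have hnet := fun S : Finset ι => exists_net_of_sign hV s hρ hε {x | x ∈ X ∧ σ x = S}
    (fun x hx => hX x hx.1) fun x hx y hy t => by
      have h : t ∈ σ x ↔ t ∈ σ y := by rw [hx.2, hy.2]
      simp only [σ, Finset.mem_filter, Finset.mem_univ, true_and] at h
      rcases le_or_gt 0 ((x : ι → ℝ) t) with h0 | h0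
      · exact mul_nonneg h0 (h.1 h0)
      · exact (mul_pos_of_neg_of_neg h0 (lt_of_not_ge fun h' => h0.not_ge (h.2 h'))).le
  choose N hNX hcard hN using hnet
  refine ⟨(signPatterns V).biUnion N, ?_, ?_, fun x hx => ?_⟩
  · intro x hx
    obtain ⟨S, -, hS⟩ := Finset.mem_biUnion.1 (Finset.mem_coe.1 hx)
    exact (hNX S hS).1
  · calc ((((signPatterns V).biUnion N).card : ℕ) : ℝ)
        ≤ ∑ S ∈ signPatterns V, ((N S).card : ℝ) := by exact_mod_cast Finset.card_biUnion_le
      _ ≤ ∑ _S ∈ signPatterns V, (1 + 4 / ε) ^ k := Finset.sum_le_sum fun S _ => hcard S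
      _ = (signPatterns V).card * (1 + 4 / ε) ^ k := by rw [Finset.sum_const, nsmul_eq_mul]
      _ ≤ (Real.exp 1 * Fintype.card ι / k) ^ k * (1 + 4 / ε) ^ k := by
          gcongr
          exact card_signPatterns_le hV hk hkn
      _ = _ := by rw [mul_pow]
  · obtain ⟨y, hy, hxy⟩ := hN (σ x) x ⟨hx, rfl⟩
    exact ⟨y, Finset.mem_biUnion.2 ⟨σ x, mem_signPatterns x.2, hy⟩, hxy⟩

end SquareNet

section LeastSquares

lemma exists_submodule_sqVec_mem {ι : Type*} [Fintype ι] {V : Submodule ℝ (ι → ℝ)} {k : ℕ}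
    (hV : Module.finrank ℝ V ≤ k) :
    ∃ W : Submodule ℝ (EuclideanSpace ℝ ι), 2 * Module.finrank ℝ W ≤ (k + 1) * k ∧
      ∀ x ∈ V, sqVec x ∈ W := by
  let b := Module.finBasis ℝ V
  let p : Sym2 (Fin (Module.finrank ℝ V)) → EuclideanSpace ℝ ι :=
    Sym2.lift ⟨fun i j => WithLp.toLp 2 ((b i : ι → ℝ) * (b j : ι → ℝ)), fun _ _ =>
      congrArg (WithLp.toLp 2) (mul_comm _ _)⟩
  refine ⟨Submodule.span ℝ (Set.range p), ?_, fun x hx => ?_⟩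
  · have h := finrank_range_le_card (R := ℝ) p
    rw [Sym2.card, Fintype.card_fin, Nat.choose_two_right, Nat.add_sub_cancel] at h
    calc 2 * Set.finrank ℝ (Set.range p)
        ≤ 2 * ((Module.finrank ℝ V + 1) * Module.finrank ℝ V / 2) := Nat.mul_le_mul_left 2 h
      _ ≤ (Module.finrank ℝ V + 1) * Module.finrank ℝ V := Nat.mul_div_le _ _
      _ ≤ (k + 1) * k := by gcongr
  · have hrepr : x = ∑ i, b.repr ⟨x, hx⟩ i • (b i : ι → ℝ) := by
      have h := congrArg Subtype.val (b.sum_repr ⟨x, hx⟩).symm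
      simpa only [Submodule.coe_sum, Submodule.coe_smul] using h
    have hexp : sqVec x = ∑ i, ∑ j, (b.repr ⟨x, hx⟩ i * b.repr ⟨x, hx⟩ j) • p s(i, j) := by
      have hxx : sqVec x = WithLp.toLp 2 (x * x) := by
        ext t
        simp [sqVec, sq]
      rw [hxx]
      conv_lhs => rw [hrepr, Finset.sum_mul_sum]
      ext t
      simp only [p, Sym2.lift_mk, WithLp.ofLp_sum, WithLp.ofLp_smul, Finset.sum_apply,
        Pi.smul_apply, Pi.mul_apply, smul_eq_mul]
      exact Finset.sum_congr rfl fun i _ => Finset.sum_congr rfl fun j _ => by ring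
    rw [hexp]
    exact Submodule.sum_mem _ fun i _ => Submodule.sum_mem _ fun j _ =>
      Submodule.smul_mem _ _ (Submodule.subset_span ⟨_, rfl⟩)

lemma twelve_le_of_pow_lt_three_pow {k n D : ℕ} (hkn : k ≤ n) (hD : 2 * D ≤ (k + 1) * k)
    (h : ((98 * n : ℕ) : ℝ) ^ k < 3 ^ D) : 12 ≤ k := by
  have h' : (98 * n) ^ k < 3 ^ D := by exact_mod_cast h
  have hpow : ((98 * n) ^ 2) ^ k < (3 ^ (k + 1)) ^ k := by
    calc ((98 * n) ^ 2) ^ k = ((98 * n) ^ k) ^ 2 := by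
          rw [← pow_mul, ← pow_mul, mul_comm 2 k]
      _ < (3 ^ D) ^ 2 := Nat.pow_lt_pow_left h' two_ne_zero
      _ = 3 ^ (2 * D) := by rw [← pow_mul, mul_comm]
      _ ≤ 3 ^ ((k + 1) * k) := Nat.pow_le_pow_right (by norm_num) hD
      _ = _ := by rw [pow_mul]
  have hlt : (98 * n) ^ 2 < 3 ^ (k + 1) := lt_of_pow_lt_pow_left₀ k (Nat.zero_le _) hpow
  have hk : (98 * k) ^ 2 < 3 ^ (k + 1) := (Nat.pow_le_pow_left (by omega) 2).trans_lt hlt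
  by_contra! hk12
  interval_cases k <;> simp_all

lemma seven_le_log {n : ℕ} (hn : 12 ≤ n) : 7 ≤ Real.log (98 * n) := by
  have hn' : (12 : ℝ) ≤ n := by exact_mod_cast hn
  rw [Real.le_log_iff_exp_le (by positivity)]
  calc Real.exp 7 = Real.exp 1 ^ 7 := by rw [← Real.exp_nat_mul]; norm_num
    _ ≤ 2.7182818286 ^ 7 := by gcongr; exact Real.exp_one_lt_d9.le
    _ ≤ 98 * n := by norm_num; linarith

lemma two_mul_pow_le {k : ℕ} (hk : 12 ≤ k) {x : ℝ} (hx : 0 ≤ x) :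
    2 * (90 * x) ^ k ≤ (98 * x) ^ k := by
  have hk' : (12 : ℝ) ≤ k := by exact_mod_cast hk
  have hb : (2 : ℝ) ≤ (1 + 8 / 90) ^ k := by
    have := one_add_mul_le_pow (a := (8 / 90 : ℝ)) (by norm_num) k
    linarith
  calc 2 * (90 * x) ^ k ≤ (1 + 8 / 90) ^ k * (90 * x) ^ k := by gcongr
    _ = (98 * x) ^ k := by
      rw [← mul_pow]
      ring

lemma net_size_le {k D : ℕ} {n ℓ L : ℝ} (hn : 0 ≤ n) (hk : 12 ≤ k)
    (hD : 2 * D ≤ (k + 1) * k) (hL : 7 ≤ L) (hℓ : 0 ≤ ℓ) (hDL : k * L ≤ D * Real.log 3) :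
    Real.exp 1 * n / k *
      (1 + 4 / (0.0112 * (ℓ + k * L) / (ℓ + Real.log 2 + D * Real.log 3))) ≤ 90 * n := by
  have hk' : (12 : ℝ) ≤ k := by exact_mod_cast hk
  have hD' : 2 * (D : ℝ) ≤ (k + 1) * k := by exact_mod_cast hD
  have hlog2 := Real.log_two_lt_d9
  have hlog2' := Real.log_two_gt_d9
  have hlog3 := Real.log_three_lt_d9
  have hkL : 0 < k * L := by positivity
  have hratio : (ℓ + Real.log 2 + D * Real.log 3) / (ℓ + k * L) ≤
      (Real.log 2 + D * Real.log 3) / (k * L) := by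
    rw [div_le_div_iff₀ (by positivity) hkL]
    nlinarith
  have hDlog : (D : ℝ) * Real.log 3 ≤ (k + 1) * k / 2 * 1.0987 :=
    mul_le_mul (by linarith) (by linarith) (Real.log_nonneg (by norm_num)) (by positivity)
  have hratio' : (Real.log 2 + D * Real.log 3) / (k * L) ≤ (0.0084 + 0.0785 * (k + 1)) := by
    rw [div_le_iff₀ hkL]
    nlinarith [mul_le_mul_of_nonneg_left hL (by positivity : (0 : ℝ) ≤ k),
      mul_le_mul_of_nonneg_left hL (by positivity : (0 : ℝ) ≤ (k + 1) * k)]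
  have hfour : 4 / (0.0112 * (ℓ + k * L) / (ℓ + Real.log 2 + D * Real.log 3)) =
      4 / 0.0112 * ((ℓ + Real.log 2 + D * Real.log 3) / (ℓ + k * L)) := by
    have h1 : 0 < ℓ + Real.log 2 + D * Real.log 3 := by
      have := Real.log_nonneg (by norm_num : (1 : ℝ) ≤ 3)
      positivity
    have h2 : 0 < ℓ + k * L := by positivity
    field_simp
  rw [hfour, div_mul_eq_mul_div, div_le_iff₀ (by positivity)]
  have hb : 1 + 4 / 0.0112 * ((ℓ + Real.log 2 + D * Real.log 3) / (ℓ + k * L)) ≤ 33 * k := by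
    have := hratio.trans hratio'
    norm_num at this ⊢
    linarith
  calc _ ≤ Real.exp 1 * n * (33 * k) := by gcongr
    _ ≤ 2.7182818286 * n * (33 * k) := by gcongr; exact Real.exp_one_lt_d9.le
    _ ≤ _ := by nlinarith [mul_nonneg hn (by positivity : (0 : ℝ) ≤ k)]

/-- Transfer of the basic inequality `‖f‖ ^ 2 ≤ 2 ⟪f, z⟫` to a nearby point `g`. -/
lemma le_inner_of_near {E : Type*} [NormedAddCommGroup E] [InnerProductSpace ℝ E]
    (W : Submodule ℝ E) [W.HasOrthogonalProjection] {f g z : E} {R T a : ℝ}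
    (hf : f - g ∈ W) (hR : 0 < R) (hfR : R ≤ ‖f‖) (hz : ‖W.orthogonalProjectionOnto z‖ ≤ T)
    (hfg : ‖f - g‖ ≤ a) (haR : a ≤ 0.028 * R) (haT : 2 * (a * T) ≤ 0.028 * R ^ 2)
    (hbasic : ‖f‖ ^ 2 ≤ 2 * ⟪f, z⟫) :
    √2 / 3 * R * ‖g‖ ≤ ⟪g, z⟫ := by
  have hproj : ⟪f - g, z⟫ ≤ a * T := by
    have := W.inner_orthogonalProjectionOnto_eq_of_mem_left ⟨f - g, hf⟩ z
    rw [← this]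
    exact (real_inner_le_norm _ _).trans
      (mul_le_mul hfg hz (norm_nonneg _) ((norm_nonneg _).trans hfg))
  have hsub : ⟪f, z⟫ = ⟪g, z⟫ + ⟪f - g, z⟫ := by rw [← inner_add_left]; congr 1; abel
  have hg : ‖g‖ ≤ ‖f‖ + a := by
    have := norm_sub_norm_le g f
    rw [norm_sub_rev] at this
    linarith
  have hs : √2 / 3 ≤ 0.47145 := by
    have : √2 ≤ 1.41435 := Real.sqrt_le_iff.2 ⟨by norm_num, by norm_num⟩
    linarith
  have h1 : √2 / 3 * R * ‖g‖ ≤ 0.47145 * R * (‖f‖ + 0.028 * R) := by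
    gcongr
    linarith
  nlinarith [mul_nonneg (sub_nonneg.2 hfR) hR.le]

lemma radius_le {R T ε : ℝ} (hR : 0 < R) (hT : 0 < T) (hε : 0 < ε) (hε1 : ε ≤ 0.0112)
    (hεT : ε * T ^ 2 = 0.0028 * R ^ 2) (hRT : R ≤ 2 * T) :
    2 * T * (2.45 * ε + ε ^ 2 / 2) ≤ 0.028 * R ∧
      2 * (2 * T * (2.45 * ε + ε ^ 2 / 2) * T) ≤ 0.028 * R ^ 2 := by
  have ha : 2 * T * (2.45 * ε + ε ^ 2 / 2) ≤ 2 * T * (2.456 * ε) := by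
    gcongr
    nlinarith
  have hεR : T * ε ≤ 0.0056 * R := by
    refine le_of_mul_le_mul_right ?_ hT
    nlinarith [mul_le_mul_of_nonneg_left hRT hR.le]
  constructor
  · linarith
  · have := mul_le_mul_of_nonneg_right ha hT.le
    nlinarith [sq_nonneg R]

/-- A Gaussian vector is unlikely to correlate strongly with a difference of coordinatewise squares
of elements of a low-dimensional subspace. -/
lemma stdGaussian_real_exists_sqVec_sub_le {n k : ℕ} {V : Submodule ℝ (Fin n → ℝ)}
    (hV : Module.finrank ℝ V ≤ k) (hkn : k ≤ n) {s : Fin n → ℝ} (hs : s ∈ V)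
    {δ : ℝ} (hδ0 : 0 < δ) (hδ1 : δ < 1) :
    (stdGaussian (EuclideanSpace ℝ (Fin n))).real {z | ∃ x ∈ V,
      9 * (Real.log (1 / δ) + k * Real.log (98 * n)) ≤ ‖sqVec x - sqVec s‖ ^ 2 ∧
        ‖sqVec x - sqVec s‖ ^ 2 ≤ 2 * ⟪sqVec x - sqVec s, z⟫} ≤ δ := by
  obtain ⟨W, hWD, hW⟩ := exists_submodule_sqVec_mem hV
  set D := Module.finrank ℝ W
  set G := stdGaussian (EuclideanSpace ℝ (Fin n))
  set ℓ := Real.log (1 / δ) with hℓ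
  set L := Real.log (98 * n) with hL
  have hℓ0 : 0 < ℓ := Real.log_pos (one_lt_one_div hδ0 hδ1)
  have hexpℓ : Real.exp (-ℓ) = δ := by
    rw [hℓ, one_div, Real.log_inv, neg_neg, Real.exp_log hδ0]
  have hL0 : 0 ≤ L := by
    rw [hL]
    exact_mod_cast Real.log_natCast_nonneg (98 * n)
  have hQ : 0 < ℓ + k * L := by positivity
  have hexpQ : Real.exp (-(ℓ + k * L)) * (98 * n : ℝ) ^ k = δ := by
    rcases Nat.eq_zero_or_pos k with rfl | hk
    · simp [hexpℓ]
    · have hn : (0 : ℝ) < 98 * n := by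
        have : 0 < n := hk.trans_le hkn
        positivity
      rw [neg_add, Real.exp_add, hexpℓ, mul_assoc, ← Real.exp_log (pow_pos hn k), ← Real.exp_add,
        Real.log_pow]
      simp [hL]
  have hproj : ∀ x ∈ V, ∀ z, ‖sqVec x - sqVec s‖ ^ 2 ≤ 2 * ⟪sqVec x - sqVec s, z⟫ →
      ‖sqVec x - sqVec s‖ ≤ 2 * ‖W.orthogonalProjectionOnto z‖ := by
    intro x hx z h
    have hmem : sqVec x - sqVec s ∈ W := W.sub_mem (hW x hx) (hW s hs)
    have hin := W.inner_orthogonalProjectionOnto_eq_of_mem_left ⟨_, hmem⟩ z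
    have hcs := real_inner_le_norm (⟨_, hmem⟩ : W) (W.orthogonalProjectionOnto z)
    rw [hin, Submodule.coe_norm] at hcs
    by_contra! hlt
    nlinarith [norm_nonneg (sqVec x - sqVec s), norm_nonneg (W.orthogonalProjectionOnto z)]
  rcases le_or_gt ((3 : ℝ) ^ D) ((98 * n : ℝ) ^ k) with hsmall | hbig
  · -- the span of the squares has small dimension: bound the projection of the noise
    calc _ ≤ G.real {z | 9 / 4 * (ℓ + k * L) ≤ ‖W.orthogonalProjectionOnto z‖ ^ 2} := by
          refine measureReal_mono ?_
          rintro z ⟨x, hx, hxR, hxz⟩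
          have := pow_le_pow_left₀ (norm_nonneg _) (hproj x hx z hxz) 2
          simp only [Set.mem_ofPred_eq]
          linarith
      _ ≤ 3 ^ D * Real.exp (-(4 / 9) * (9 / 4 * (ℓ + k * L))) :=
          stdGaussian_real_norm_orthogonalProjection_ge_le W _
      _ ≤ (98 * n : ℝ) ^ k * Real.exp (-(ℓ + k * L)) := by
          gcongr
          linarith
      _ = δ := by rw [mul_comm, hexpQ]
  -- otherwise the dimension is large, and a union bound over a net applies
  have hk : 12 ≤ k := twelve_le_of_pow_lt_three_pow hkn hWD (by push_cast; exact hbig)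
  have hn : (0 : ℝ) < 98 * n := by
    have : 0 < n := by omega
    positivity
  have hL7 : 7 ≤ L := seven_le_log (hk.trans hkn)
  have hDL : k * L ≤ D * Real.log 3 := by
    have := Real.log_le_log (pow_pos hn k) hbig.le
    rwa [Real.log_pow, Real.log_pow] at this
  have hlog2 : 0 < Real.log 2 := Real.log_pos (by norm_num)
  set Q := ℓ + k * L with hQdef
  set Q' := ℓ + Real.log 2 + D * Real.log 3 with hQ'def
  have hQQ' : Q ≤ Q' := by linarith
  have hQ' : 0 < Q' := hQ.trans_le hQQ'
  have hnoise : G.real {z | 9 / 4 * Q' ≤ ‖W.orthogonalProjectionOnto z‖ ^ 2} ≤ δ / 2 := by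
    refine (stdGaussian_real_norm_orthogonalProjection_ge_le W _).trans (le_of_eq ?_)
    rw [show -(4 / 9) * (9 / 4 * Q') = -ℓ + (-Real.log 2 + -(D * Real.log 3)) by rw [hQ'def]; ring,
      Real.exp_add, Real.exp_add, hexpℓ, Real.exp_neg, Real.exp_neg, Real.exp_nat_mul,
      Real.exp_log two_pos, Real.exp_log three_pos]
    change (3 : ℝ) ^ D * _ = _
    field_simp
  set R := 3 * √Q with hRdef
  have hR : 0 < R := by positivity
  have hR2 : R ^ 2 = 9 * Q := by rw [hRdef, mul_pow, Real.sq_sqrt hQ.le]; norm_num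
  set T := 3 / 2 * √Q' with hTdef
  have hT : 0 < T := by positivity
  have hT2 : T ^ 2 = 9 / 4 * Q' := by rw [hTdef, mul_pow, Real.sq_sqrt hQ'.le]; norm_num
  set ε := 0.0112 * Q / Q' with hεdef
  have hε : 0 < ε := by positivity
  have hε1 : ε ≤ 0.0112 := by
    rw [hεdef, div_le_iff₀ hQ']
    linarith
  have hεT : ε * T ^ 2 = 0.0028 * R ^ 2 := by
    rw [hT2, hR2, hεdef]
    field_simp
    norm_num
  have hRT : R ≤ 2 * T := by
    rw [hRdef, hTdef]
    linarith [Real.sqrt_le_sqrt hQQ']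
  obtain ⟨N, hNX, hNcard, hN⟩ := exists_net hV (by omega) (by simpa using hkn) s
    (by positivity : 0 < 2 * T) hε
    {x : V | R ≤ ‖sqVec (x : Fin n → ℝ) - sqVec s‖ ∧ ‖sqVec (x : Fin n → ℝ) - sqVec s‖ ≤ 2 * T}
    fun x hx => hx.2
  obtain ⟨haR, haT⟩ := radius_le hR hT hε hε1 hεT hRT
  set a := 2 * T * (2.45 * ε + ε ^ 2 / 2)
  have hsub : {z | ∃ x ∈ V, 9 * Q ≤ ‖sqVec x - sqVec s‖ ^ 2 ∧
        ‖sqVec x - sqVec s‖ ^ 2 ≤ 2 * ⟪sqVec x - sqVec s, z⟫} ⊆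
      {z | 9 / 4 * Q' ≤ ‖W.orthogonalProjectionOnto z‖ ^ 2} ∪
        ⋃ y ∈ N, {z | √2 / 3 * R * ‖sqVec (y : Fin n → ℝ) - sqVec s‖ ≤
          ⟪sqVec (y : Fin n → ℝ) - sqVec s, z⟫} := by
    rintro z ⟨x, hx, hxR, hxz⟩
    rw [Set.mem_union, or_iff_not_imp_left]
    intro hz
    have hzT : ‖W.orthogonalProjectionOnto z‖ ≤ T := by
      simp only [Set.mem_ofPred_eq, not_le] at hz
      exact le_of_sq_le_sq (by rw [hT2]; exact hz.le) hT.le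
    have hRx : R ≤ ‖sqVec x - sqVec s‖ :=
      le_of_sq_le_sq (by rw [hR2]; exact hxR) (norm_nonneg _)
    obtain ⟨y, hy, hxy⟩ := hN ⟨x, hx⟩ ⟨hRx, by linarith [hproj x hx z hxz]⟩
    refine Set.mem_biUnion hy ?_
    rw [← sub_sub_sub_cancel_right _ _ (sqVec s)] at hxy
    refine le_inner_of_near W ?_ hR hRx hzT hxy haR haT hxz
    exact W.sub_mem (W.sub_mem (hW x hx) (hW s hs)) (W.sub_mem (hW y y.2) (hW s hs))
  have hpoint : ∀ y ∈ N, G.real {z | √2 / 3 * R * ‖sqVec (y : Fin n → ℝ) - sqVec s‖ ≤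
      ⟪sqVec (y : Fin n → ℝ) - sqVec s, z⟫} ≤ Real.exp (-Q) := by
    intro y hy
    have hy0 : sqVec (y : Fin n → ℝ) - sqVec s ≠ 0 :=
      norm_pos_iff.1 (hR.trans_le (hNX hy).1)
    refine (stdGaussian_real_inner_ge_le hy0 (by positivity)).trans (le_of_eq ?_)
    rw [mul_pow, div_pow, Real.sq_sqrt two_pos.le, hR2]
    congr 1
    ring
  calc _ ≤ _ := measureReal_mono hsub
    _ ≤ _ := measureReal_union_le _ _
    _ ≤ δ / 2 + ∑ y ∈ N, G.real {z | √2 / 3 * R * ‖sqVec (y : Fin n → ℝ) - sqVec s‖ ≤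
          ⟪sqVec (y : Fin n → ℝ) - sqVec s, z⟫} :=
        add_le_add hnoise (measureReal_biUnion_finset_le _ _)
    _ ≤ δ / 2 + N.card * Real.exp (-Q) := by
        gcongr
        exact (Finset.sum_le_sum hpoint).trans_eq (by rw [Finset.sum_const, nsmul_eq_mul])
    _ ≤ δ / 2 + (98 * n : ℝ) ^ k / 2 * Real.exp (-Q) := by
        gcongr
        have hsize := net_size_le (n := n) (by positivity) hk hWD hL7 hℓ0.le hDL
        rw [Fintype.card_fin] at hNcard
        have := hNcard.trans (pow_le_pow_left₀ (by positivity) hsize k)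
        linarith [two_mul_pow_le hk (Nat.cast_nonneg (α := ℝ) n)]
    _ = δ := by linarith

end LeastSquares

section Reduction

lemma finrank_range_pi_inner_le {E : Type*} [NormedAddCommGroup E] [InnerProductSpace ℝ E]
    {ι : Type*} [Finite ι] (A : ι → E) :
    Module.finrank ℝ (LinearMap.pi fun t => innerₛₗ ℝ (A t) : E →ₗ[ℝ] (ι → ℝ)).range ≤
      Module.finrank ℝ (Submodule.span ℝ (Set.range A)) := by
  have := FiniteDimensional.span_of_finite ℝ (Set.finite_range A)
  refine (Submodule.finrank_mono ?_).trans (Submodule.finrank_map_le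
    (LinearMap.pi fun t => innerₛₗ ℝ (A t) : E →ₗ[ℝ] (ι → ℝ)) (Submodule.span ℝ (Set.range A)))
  rintro _ ⟨θ, rfl⟩
  refine ⟨(Submodule.span ℝ (Set.range A)).orthogonalProjectionOnto θ, Subtype.property _, ?_⟩
  ext t
  exact (Submodule.span ℝ (Set.range A)).inner_orthogonalProjectionOnto_eq_of_mem_left
    ⟨A t, Submodule.subset_span ⟨t, rfl⟩⟩ θ

/-- The basic inequality for least squares. -/
lemma norm_sq_le_two_mul_inner_of_sum_sq_le {ι : Type*} [Fintype ι] {x s e : ι → ℝ}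
    (h : ∑ t, ((s t ^ 2 + e t) - x t ^ 2) ^ 2 ≤ ∑ t, ((s t ^ 2 + e t) - s t ^ 2) ^ 2) :
    ‖sqVec x - sqVec s‖ ^ 2 ≤ 2 * ⟪sqVec x - sqVec s, WithLp.toLp 2 e⟫ := by
  have hinner : ⟪sqVec x - sqVec s, WithLp.toLp 2 e⟫ = ∑ t, (x t ^ 2 - s t ^ 2) * e t := by
    simp [sqVec, PiLp.inner_apply, mul_comm]
  rw [norm_sqVec_sub_sq, hinner, Finset.mul_sum, ← sub_nonneg, ← Finset.sum_sub_distrib]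
  rw [← sub_nonneg, ← Finset.sum_sub_distrib] at h
  exact h.trans_eq (Finset.sum_congr rfl fun t _ => by ring)

end Reduction

/-- **Concentration for the constrained least-squares estimator, span version
(Corollary 9(a) of the paper).**  Let `A_1, …, A_n` be fixed vectors whose span has
dimension `k`, `η_1, …, η_n` i.i.d. standard Gaussians, `θ⋆ ∈ Θ ⊆ B^d_1`, rewards
`X_t = ⟪A_t, θ⋆⟫² + η_t`, and let `θ̂` minimize
`L(θ) = (1/2) ∑_t (X_t − ⟪A_t, θ⟫²)²` over `Θ`.  Then for any `δ ∈ (0,1)`, the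
probability that `∑_t ⟪A_t, θ̂ − θ⋆⟫² ⟪A_t, θ̂ + θ⋆⟫² ≥ 9 (log(1/δ) + k log(98 n))`
is at most `δ`. -/
theorem least_squares_concentration_span {d n : ℕ} {Ω : Type} [MeasurableSpace Ω]
    (μ : Measure Ω) [IsProbabilityMeasure μ]
    (η : Fin n → Ω → ℝ)
    (hη : Measure.map (fun ω => fun t => η t ω) μ =
      Measure.pi (fun _ : Fin n => gaussianReal 0 1))
    (A : Fin n → EuclideanSpace ℝ (Fin d)) (k : ℕ)
    (hk : Module.finrank ℝ (Submodule.span ℝ (Set.range A)) = k)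
    (Θ : Set (EuclideanSpace ℝ (Fin d))) (hΘ : Θ ⊆ Metric.closedBall 0 1)
    (θstar : EuclideanSpace ℝ (Fin d)) (hθstar : θstar ∈ Θ)
    (θhat : Ω → EuclideanSpace ℝ (Fin d))
    (hmem : ∀ ω, θhat ω ∈ Θ)
    (hmin : ∀ ω, ∀ θ ∈ Θ,
      (1 / 2) * ∑ t, (((⟪A t, θstar⟫) ^ 2 + η t ω) - (⟪A t, θhat ω⟫) ^ 2) ^ 2 ≤
        (1 / 2) * ∑ t, (((⟪A t, θstar⟫) ^ 2 + η t ω) - (⟪A t, θ⟫) ^ 2) ^ 2)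
    (δ : ℝ) (hδ0 : 0 < δ) (hδ1 : δ < 1) :
    μ {ω | 9 * (Real.log (1 / δ) + k * Real.log (98 * n)) ≤
        ∑ t, (⟪A t, θhat ω - θstar⟫) ^ 2 * (⟪A t, θhat ω + θstar⟫) ^ 2}
      ≤ ENNReal.ofReal δ := by
  let T : EuclideanSpace ℝ (Fin d) →ₗ[ℝ] (Fin n → ℝ) := LinearMap.pi fun t => innerₛₗ ℝ (A t)
  have hV : Module.finrank ℝ T.range ≤ k := hk ▸ finrank_range_pi_inner_le A
  have hkn : k ≤ n := by
    simpa [Set.finrank, hk] using finrank_range_le_card (R := ℝ) A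
  set B : Set (EuclideanSpace ℝ (Fin n)) := {z | ∃ x ∈ T.range,
    9 * (Real.log (1 / δ) + k * Real.log (98 * n)) ≤ ‖sqVec x - sqVec (T θstar)‖ ^ 2 ∧
      ‖sqVec x - sqVec (T θstar)‖ ^ 2 ≤ 2 * ⟪sqVec x - sqVec (T θstar), z⟫}
  have hB : stdGaussian (EuclideanSpace ℝ (Fin n)) B ≤ ENNReal.ofReal δ := by
    rw [ENNReal.le_ofReal_iff_toReal_le (measure_ne_top _ _) hδ0.le]
    exact stdGaussian_real_exists_sqVec_sub_le hV hkn ⟨θstar, rfl⟩ hδ0 hδ1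
  have hηm : AEMeasurable (fun ω t => η t ω) μ :=
    aemeasurable_of_map_neZero (by rw [hη]; infer_instance)
  have hto : Measurable (WithLp.toLp 2 : (Fin n → ℝ) → EuclideanSpace ℝ (Fin n)) := by fun_prop
  have hmap : μ.map (fun ω => WithLp.toLp 2 fun t => η t ω) =
      stdGaussian (EuclideanSpace ℝ (Fin n)) := by
    rw [← map_pi_eq_stdGaussian, ← hη,
      AEMeasurable.map_map_of_aemeasurable hto.aemeasurable hηm]
    rfl
  calc _ ≤ μ ((fun ω => WithLp.toLp 2 fun t => η t ω) ⁻¹' B) := by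
        refine measure_mono fun ω hω => ⟨T (θhat ω), ⟨_, rfl⟩, ?_, ?_⟩
        · rw [norm_sqVec_sub_sq]
          refine (Set.mem_ofPred_eq ▸ hω :).trans_eq (Finset.sum_congr rfl fun t _ => ?_)
          simp only [T, LinearMap.pi_apply, innerₛₗ_apply_apply, inner_sub_right, inner_add_right]
          ring
        · exact norm_sq_le_two_mul_inner_of_sum_sq_le
            (le_of_mul_le_mul_left (hmin ω θstar hθstar) one_half_pos)
    _ ≤ μ.map (fun ω => WithLp.toLp 2 fun t => η t ω) B :=
        Measure.le_map_apply (hto.comp_aemeasurable hηm) _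
    _ ≤ ENNReal.ofReal δ := hmap ▸ hB
end

section
/- Let A_1, …, A_n ∈ ℝ^d be fixed vectors whose span has dimension k, let η_1, …, η_n be independent standard Gaussian random variables, let θ⋆ ∈ Θ where Θ ⊆ B^d_1, set X_t = ⟨A_t, θ⋆⟩² + η_t, and let θ̂ minimize L(θ) = (1/2) Σ_{t=1}^n (X_t − ⟨A_t, θ⟩²)² over Θ. Then E[ Σ_{t=1}^n ⟨A_t, θ̂ − θ⋆⟩² · ⟨A_t, θ̂ + θ⋆⟩² ] ≤ 9·(1 + k·log(98n)). -/
open MeasureTheory ProbabilityTheory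
open scoped RealInnerProductSpace

lemma factorial_mul_det_transpose_mul_self {m n : Type*} [Fintype m] [DecidableEq m] [Fintype n]
    [DecidableEq n] (X : Matrix m n ℝ) :
    ((Fintype.card n).factorial : ℝ) * (X.transpose * X).det =
      ∑ φ : n → m, (X.submatrix φ id).det ^ 2 := by
  have key : (X.transpose * X).det = ∑ φ : n → m, (∏ i, X (φ i) i) * (X.submatrix φ id).det := by
    simp only [Matrix.det_apply', Matrix.mul_apply, Finset.prod_univ_sum, Finset.mul_sum,
      Fintype.piFinset_univ, Matrix.transpose_apply, Matrix.submatrix_apply, id]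
    rw [Finset.sum_comm]
    refine Finset.sum_congr rfl fun φ _ => ?_
    rw [← Equiv.sum_comp (Equiv.inv (Equiv.Perm n))]
    refine Finset.sum_congr rfl fun σ _ => ?_
    simp only [Equiv.inv_apply, Equiv.Perm.sign_inv, Finset.prod_mul_distrib]
    rw [← Equiv.prod_comp σ (fun i => X (φ i) (σ⁻¹ i))]
    have hinv (i : n) : σ⁻¹ (σ i) = i := σ.symm_apply_apply i
    simp_rw [hinv]
    ring
  have reindex (π : Equiv.Perm n) : (X.transpose * X).det =
      ∑ φ : n → m, (Equiv.Perm.sign π * ∏ i, X (φ (π i)) i) * (X.submatrix φ id).det := by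
    rw [key, ← Equiv.sum_comp (Equiv.arrowCongr π.symm (Equiv.refl m))]
    refine Finset.sum_congr rfl fun φ _ => ?_
    have hdet := Matrix.det_permute π (X.submatrix φ id)
    rw [Matrix.submatrix_submatrix, Function.comp_id] at hdet
    change (∏ i, X (φ (π i)) i) * (X.submatrix (φ ∘ π) id).det = _
    rw [hdet]
    ring
  calc ((Fintype.card n).factorial : ℝ) * (X.transpose * X).det
      = ∑ _π : Equiv.Perm n, (X.transpose * X).det := by
        simp [Fintype.card_perm]
    _ = ∑ φ : n → m, ∑ π : Equiv.Perm n,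
          (Equiv.Perm.sign π * ∏ i, X (φ (π i)) i) * (X.submatrix φ id).det := by
        rw [Finset.sum_comm]
        exact Finset.sum_congr rfl fun π _ => reindex π
    _ = _ := by
        refine Finset.sum_congr rfl fun φ _ => ?_
        rw [← Finset.sum_mul, sq]
        congr 1
        rw [Matrix.det_apply']
        rfl

lemma det_transpose_mul_self_le {m n : Type*} [Fintype m] [DecidableEq m] [Fintype n]
    [DecidableEq n] (X : Matrix m n ℝ) :
    (X.transpose * X).det ≤
      ((∑ φ : n → m, |(X.submatrix φ id).det|) / (Fintype.card n).factorial) ^ 2 := by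
  have hfac : (0 : ℝ) < (Fintype.card n).factorial := by positivity
  set T := ∑ φ : n → m, |(X.submatrix φ id).det| with hT
  have hle (φ : n → m) :
      ((Fintype.card n).factorial : ℝ) * (X.submatrix φ id).det ^ 2
        ≤ |(X.submatrix φ id).det| * T := by
    by_cases hφ : Function.Injective φ
    · have hperm : ∑ π : Equiv.Perm n, |(X.submatrix (φ ∘ π) id).det| ≤ T := by
        have hinj : Function.Injective (fun π : Equiv.Perm n => φ ∘ π) := fun π ρ h =>
          Equiv.ext fun i => hφ (congrFun h i)
        rw [hT, ← Finset.sum_image (f := fun ψ => |(X.submatrix ψ id).det|)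
          (s := Finset.univ) (hinj.injOn)]
        exact Finset.sum_le_sum_of_subset_of_nonneg (Finset.subset_univ _)
          fun _ _ _ => abs_nonneg _
      have hconst (π : Equiv.Perm n) :
          |(X.submatrix (φ ∘ π) id).det| = |(X.submatrix φ id).det| := by
        have := Matrix.det_permute π (X.submatrix φ id)
        rw [Matrix.submatrix_submatrix, Function.comp_id] at this
        rw [this, abs_mul]
        rcases Int.units_eq_one_or (Equiv.Perm.sign π) with h | h <;> simp [h]
      simp only [hconst, Finset.sum_const, Finset.card_univ, Fintype.card_perm,
        nsmul_eq_mul] at hperm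
      rw [← sq_abs]
      nlinarith [abs_nonneg (X.submatrix φ id).det]
    · obtain ⟨i, j, hij, hne⟩ : ∃ i j, φ i = φ j ∧ i ≠ j := by
        simpa [Function.Injective] using hφ
      have : (X.submatrix φ id).det = 0 :=
        Matrix.det_zero_of_row_eq hne (by ext l; simp [hij])
      simp [this]
  have h := factorial_mul_det_transpose_mul_self X
  have hsum := Finset.sum_le_sum fun φ (_ : φ ∈ Finset.univ) => hle φ
  rw [← Finset.mul_sum, ← Finset.sum_mul, ← h, ← hT] at hsum
  rw [div_pow, le_div_iff₀ (by positivity)]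
  nlinarith

lemma lintegral_ofReal_prod_eval {ι : Type*} [Fintype ι] (ν : ι → Measure ℝ)
    [∀ i, SigmaFinite (ν i)] (q : ι → ℝ → ℝ) (hq : ∀ i y, 0 ≤ q i y)
    (hint : ∀ i, Integrable (q i) (ν i)) :
    ∫⁻ y : ι → ℝ, ENNReal.ofReal (∏ i, q i (y i)) ∂(Measure.pi ν) =
      ENNReal.ofReal (∏ i, ∫ y, q i y ∂(ν i)) := by
  rw [← integral_fintype_prod_eq_prod,
    ofReal_integral_eq_lintegral_ofReal (Integrable.fintype_prod_dep hint)]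
  exact Filter.Eventually.of_forall fun y => Finset.prod_nonneg fun i _ => hq i _

lemma lintegral_exp_linear_pi_gaussianReal {ι : Type*} [Fintype ι] (c : ι → ℝ) :
    ∫⁻ x : ι → ℝ, ENNReal.ofReal (Real.exp (∑ t, c t * x t))
        ∂(Measure.pi fun _ => gaussianReal 0 1) =
      ENNReal.ofReal (Real.exp ((∑ t, c t ^ 2) / 2)) := by
  simp_rw [Real.exp_sum]
  rw [lintegral_ofReal_prod_eval (fun _ : ι => gaussianReal 0 1) (fun t y => Real.exp (c t * y))
    (fun _ _ => (Real.exp_pos _).le) (fun t => integrable_exp_mul_gaussianReal (c t))]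
  have (t : ι) : ∫ y, Real.exp (c t * y) ∂(gaussianReal 0 1) = Real.exp (c t ^ 2 / 2) := by
    have := congrFun (mgf_id_gaussianReal (μ := 0) (v := 1)) (c t)
    simpa [mgf] using this
  simp_rw [this]
  rw [← Real.exp_sum, Finset.sum_div]

lemma integrable_sq_linear_pi_gaussianReal {ι : Type*} [Fintype ι] (c : ι → ℝ) :
    Integrable (fun x : ι → ℝ => (∑ t, c t * x t) ^ 2) (Measure.pi fun _ => gaussianReal 0 1) ∧
    ∫ x : ι → ℝ, (∑ t, c t * x t) ^ 2 ∂(Measure.pi fun _ => gaussianReal 0 1) = ∑ t, c t ^ 2 := by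
  set P : Measure (ι → ℝ) := Measure.pi fun _ => gaussianReal 0 1
  have hmp (t : ι) : MeasurePreserving (fun x : ι → ℝ => x t) P (gaussianReal 0 1) :=
    measurePreserving_eval _ t
  have hL (t : ι) : MemLp (fun y : ℝ => c t * y) 2 (gaussianReal 0 1) :=
    (memLp_id_gaussianReal 2).const_mul (c t)
  have hL' (t : ι) : MemLp (fun x : ι → ℝ => c t * x t) 2 P := (hL t).comp_measurePreserving (hmp t)
  have hS : MemLp (fun x : ι → ℝ => ∑ t, c t * x t) 2 P := memLp_finsetSum _ fun t _ => hL' t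
  refine ⟨hS.integrable_sq, ?_⟩
  have hmean : ∫ x : ι → ℝ, ∑ t, c t * x t ∂P = 0 := by
    rw [integral_finsetSum _ fun t _ => (hL' t).integrable (by norm_num)]
    refine Finset.sum_eq_zero fun t _ => ?_
    rw [integral_const_mul]
    have := integral_comp_eval (μ := fun _ : ι => gaussianReal 0 1) (i := t) (f := fun y : ℝ => y)
      measurable_id.aestronglyMeasurable
    rw [this, integral_id_gaussianReal, mul_zero]
  have hvar := variance_sum_pi (μ := fun _ : ι => gaussianReal 0 1) (X := fun t y => c t * y) hL
  have h0 : Var[fun x : ι → ℝ => ∑ t, c t * x t; P] = ∫ x : ι → ℝ, (∑ t, c t * x t) ^ 2 ∂P :=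
    variance_of_integral_eq_zero hS.aestronglyMeasurable.aemeasurable hmean
  have he : (fun x : ι → ℝ => ∑ t, c t * x t) = ∑ t, fun x : ι → ℝ => c t * x t := by
    ext x; simp
  rw [← h0, he, hvar]
  refine Finset.sum_congr rfl fun t _ => ?_
  rw [variance_const_mul, variance_fun_id_gaussianReal]
  simp

lemma integral_abs_mul_exp_quartic {κ : ℝ} (hκ : 0 < κ) (b : ℝ) :
    Integrable (fun y : ℝ => |y| * Real.exp (-κ * (y ^ 2 - b) ^ 2)) ∧
    ∫ y : ℝ, |y| * Real.exp (-κ * (y ^ 2 - b) ^ 2) ≤ √(Real.pi / κ) := by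
  set g : ℝ → ℝ := fun x => Real.exp (-κ * (x - b) ^ 2) with hg
  have hgint : Integrable g := (integrable_exp_neg_mul_sq hκ).comp_sub_right b
  have hgval : ∫ x, g x = √(Real.pi / κ) := by
    rw [← integral_gaussian]
    exact integral_sub_right_eq_self (fun x => Real.exp (-κ * x ^ 2)) b
  have hderiv : ∀ y ∈ Set.Ioi (0 : ℝ),
      HasDerivWithinAt (fun y : ℝ => y ^ 2) (2 * y) (Set.Ioi 0) y := fun y _ => by
    simpa using (hasDerivAt_pow 2 y).hasDerivWithinAt
  have hinj : Set.InjOn (fun y : ℝ => y ^ 2) (Set.Ioi 0) := fun x hx y hy h =>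
    (pow_left_inj₀ (le_of_lt hx) (le_of_lt hy) two_ne_zero).1 h
  have hIoi : IntegrableOn (fun y : ℝ => |2 * y| • g (y ^ 2)) (Set.Ioi 0) :=
    (integrableOn_image_iff_integrableOn_abs_deriv_smul measurableSet_Ioi hderiv hinj g).1
      hgint.integrableOn
  have hval := integral_image_eq_integral_abs_deriv_smul measurableSet_Ioi hderiv hinj g
  have hle : ∫ y in Set.Ioi (0 : ℝ), |2 * y| • g (y ^ 2) ≤ √(Real.pi / κ) := by
    rw [← hval, ← hgval]
    exact setIntegral_le_integral hgint (Filter.Eventually.of_forall fun x => (Real.exp_pos _).le)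
  have heq (y : ℝ) : |2 * y| • g (y ^ 2) = 2 * (|y| * Real.exp (-κ * (y ^ 2 - b) ^ 2)) := by
    simp [hg, abs_mul, mul_assoc]
  simp_rw [heq] at hIoi hle
  set h : ℝ → ℝ := fun y => y * Real.exp (-κ * (y ^ 2 - b) ^ 2)
  have habs (y : ℝ) : |y| * Real.exp (-κ * (y ^ 2 - b) ^ 2) = h |y| := by simp [h, sq_abs]
  have hIoi' : IntegrableOn (fun y : ℝ => h |y|) (Set.Ioi 0) := by
    refine (hIoi.const_mul (1 / 2)).congr (Filter.Eventually.of_forall fun y => ?_)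
    simp only [← habs]
    ring
  have hint : Integrable (fun y : ℝ => h |y|) := by
    have hIic : IntegrableOn (fun y : ℝ => h |y|) (Set.Iic 0) := by
      have hneg : MeasurableEmbedding fun x : ℝ => -x := (Homeomorph.neg ℝ).measurableEmbedding
      rw [← Measure.map_neg_eq_self (volume : Measure ℝ), hneg.integrableOn_map_iff]
      simp_rw [Function.comp_def, abs_neg, Set.neg_preimage, Set.neg_Iic,
        neg_zero]
      exact Iff.mpr integrableOn_Ici_iff_integrableOn_Ioi hIoi'
    rw [← integrableOn_univ, ← Set.Iic_union_Ioi (a := (0 : ℝ))]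
    exact hIic.union hIoi'
  simp_rw [habs] at hle ⊢
  refine ⟨hint, ?_⟩
  rw [integral_const_mul] at hle
  have hcongr : ∫ y in Set.Ioi (0 : ℝ), h |y| = ∫ y in Set.Ioi (0 : ℝ), h y :=
    setIntegral_congr_fun measurableSet_Ioi fun y hy => by
      simp only [abs_of_pos (show 0 < y from hy)]
  rwa [integral_comp_abs, ← hcongr]

lemma integral_sqrt_mul_exp_quartic {κ c β : ℝ} (hκ : 0 < κ) (hc : 0 < c) (hβ : 0 ≤ β) (b : ℝ) :
    Integrable (fun y : ℝ => √(4 * y ^ 2 + β) * Real.exp (-κ * (y ^ 2 - b) ^ 2)) ∧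
    ∫ y : ℝ, √(4 * y ^ 2 + β) * Real.exp (-κ * (y ^ 2 - b) ^ 2) ≤
      (2 + √β / c) * √(Real.pi / κ) + 2 * c * √β := by
  obtain ⟨hint, hle⟩ := integral_abs_mul_exp_quartic hκ b
  set G : ℝ → ℝ := fun y => (2 + √β / c) * (|y| * Real.exp (-κ * (y ^ 2 - b) ^ 2)) +
    (Set.Icc (-c) c).indicator (fun _ => √β) y with hG
  have hind : Integrable ((Set.Icc (-c) c).indicator fun _ : ℝ => √β) := by
    rw [integrable_indicator_iff measurableSet_Icc]
    exact integrableOn_const (by simp)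
  have hGint : Integrable G := (hint.const_mul _).add hind
  have hGval : ∫ y, G y ≤ (2 + √β / c) * √(Real.pi / κ) + 2 * c * √β := by
    rw [hG, integral_add (hint.const_mul _) hind, integral_const_mul,
      integral_indicator measurableSet_Icc, setIntegral_const]
    have : volume.real (Set.Icc (-c) c) = 2 * c := by
      rw [Real.volume_real_Icc_of_le (by linarith)]; ring
    rw [this, smul_eq_mul]
    gcongr
  have hsqrt (y : ℝ) : √(4 * y ^ 2 + β) ≤ 2 * |y| + √β := by
    rw [Real.sqrt_le_left (by positivity)]
    nlinarith [Real.sq_sqrt hβ, sq_abs y, abs_nonneg y, Real.sqrt_nonneg β,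
      mul_nonneg (abs_nonneg y) (Real.sqrt_nonneg β)]
  have hbound (y : ℝ) : √(4 * y ^ 2 + β) * Real.exp (-κ * (y ^ 2 - b) ^ 2) ≤ G y := by
    set e := Real.exp (-κ * (y ^ 2 - b) ^ 2) with he
    have he0 : 0 < e := Real.exp_pos _
    have he1 : e ≤ 1 := Real.exp_le_one_iff.2 (by nlinarith [sq_nonneg (y ^ 2 - b)])
    have h1 : √β * e ≤ √β / c * (|y| * e) + (Set.Icc (-c) c).indicator (fun _ => √β) y := by
      by_cases hy : y ∈ Set.Icc (-c) c
      · rw [Set.indicator_of_mem hy]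
        have : 0 ≤ √β / c * (|y| * e) := by positivity
        nlinarith [Real.sqrt_nonneg β]
      · rw [Set.indicator_of_notMem hy, add_zero]
        have hcy : c ≤ |y| := by
          by_contra! hlt
          exact hy (abs_le.1 hlt.le)
        calc √β * e = √β / c * (c * e) := by field_simp
          _ ≤ _ := by gcongr
    calc √(4 * y ^ 2 + β) * e ≤ (2 * |y| + √β) * e := by gcongr; exact hsqrt y
      _ ≤ G y := by simp only [hG]; linarith
  have hfint : Integrable
      (fun y : ℝ => √(4 * y ^ 2 + β) * Real.exp (-κ * (y ^ 2 - b) ^ 2)) := by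
    refine hGint.mono' (by fun_prop) (Filter.Eventually.of_forall fun y => ?_)
    rw [Real.norm_of_nonneg (by positivity)]
    exact hbound y
  exact ⟨hfint, (integral_mono hfint hGint hbound).trans hGval⟩

/-- The numerical value of the bound in `integral_sqrt_mul_exp_quartic` at `κ = 1 / 144`. -/
lemma integral_sqrt_mul_exp_quartic_le {k : ℕ} (hk : 0 < k) (b : ℝ) :
    ∫ y : ℝ, √(4 * y ^ 2 + k) * Real.exp (-(1 / 144) * (y ^ 2 - b) ^ 2) ≤ 56 * √k := by
  refine (integral_sqrt_mul_exp_quartic (by norm_num) (c := 3) (by norm_num)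
    (Nat.cast_nonneg k) b).2.trans ?_
  have h1 : 1 ≤ √(k : ℝ) := Real.one_le_sqrt.2 (by exact_mod_cast hk)
  have h2 : √(Real.pi / (1 / 144)) ≤ 21.3 := by
    rw [Real.sqrt_le_left (by norm_num)]
    nlinarith [Real.pi_lt_d4]
  nlinarith

/-- The signal `⟪a_t, v⟫ ^ 2 - b_t` seen at time `t` in coordinates `v`. -/
noncomputable def excess {n k : ℕ} (a : Matrix (Fin n) (Fin k) ℝ) (b : Fin n → ℝ)
    (v : Fin k → ℝ) (t : Fin n) : ℝ :=
  (a.mulVec v t) ^ 2 - b t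

/-- A Cauchy–Binet majorant of the Jeffreys density `√det (∑ₜ (4 ⟪a_t, v⟫² + k) a_t a_tᵀ)`. -/
noncomputable def jeffreysMajorant {n k : ℕ} (a : Matrix (Fin n) (Fin k) ℝ) (v : Fin k → ℝ) : ℝ :=
  (∑ φ : Fin k → Fin n,
    |(a.submatrix φ id).det| * ∏ i, √(4 * (a.mulVec v (φ i)) ^ 2 + k)) / k.factorial

lemma jeffreysMajorant_nonneg {n k : ℕ} (a : Matrix (Fin n) (Fin k) ℝ) (v : Fin k → ℝ) :
    0 ≤ jeffreysMajorant a v := by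
  unfold jeffreysMajorant
  positivity

lemma continuous_mulVec_apply {n k : ℕ} (a : Matrix (Fin n) (Fin k) ℝ) (t : Fin n) :
    Continuous fun v : Fin k → ℝ => a.mulVec v t := by
  unfold Matrix.mulVec dotProduct
  fun_prop

lemma continuous_excess {n k : ℕ} (a : Matrix (Fin n) (Fin k) ℝ) (b : Fin n → ℝ) (t : Fin n) :
    Continuous fun v => excess a b v t := by
  have := continuous_mulVec_apply a t
  unfold excess
  fun_prop

lemma continuous_jeffreysMajorant {n k : ℕ} (a : Matrix (Fin n) (Fin k) ℝ) :
    Continuous (jeffreysMajorant a) := by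
  have := continuous_mulVec_apply a
  unfold jeffreysMajorant
  fun_prop

lemma lintegral_minor_mul_exp_le {n k : ℕ} (hk : 0 < k) (a : Matrix (Fin n) (Fin k) ℝ)
    (b : Fin n → ℝ) (φ : Fin k → Fin n) :
    ∫⁻ v : Fin k → ℝ, ENNReal.ofReal (|(a.submatrix φ id).det| *
        (∏ i, √(4 * (a.mulVec v (φ i)) ^ 2 + k)) *
          Real.exp (-(1 / 144) * ∑ t, excess a b v t ^ 2)) ≤
      ENNReal.ofReal ((56 * √k) ^ k) := by
  set D := (a.submatrix φ id).det with hD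
  by_cases hdet : D = 0
  · simp [hdet]
  have hφ : Function.Injective φ := by
    intro i j hij
    by_contra hne
    exact hdet (Matrix.det_zero_of_row_eq hne (by ext l; simp [hij]))
  set q : Fin k → ℝ → ℝ := fun i y =>
    √(4 * y ^ 2 + k) * Real.exp (-(1 / 144) * (y ^ 2 - b (φ i)) ^ 2) with hq
  have hq0 (i : Fin k) (y : ℝ) : 0 ≤ q i y := by positivity
  have hqint (i : Fin k) : Integrable (q i) :=
    (integral_sqrt_mul_exp_quartic (by norm_num) (c := 3) (by norm_num)
      (Nat.cast_nonneg k) (b (φ i))).1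
  have hqcont (i : Fin k) : Continuous (q i) := by fun_prop
  have hQmeas : Measurable fun y : Fin k → ℝ => ENNReal.ofReal (∏ i, q i (y i)) := by
    have : Continuous fun y : Fin k → ℝ => ∏ i, q i (y i) := by fun_prop
    exact this.measurable.ennreal_ofReal
  have hpt (v : Fin k → ℝ) :
      ENNReal.ofReal (|D| * (∏ i, √(4 * (a.mulVec v (φ i)) ^ 2 + k)) *
          Real.exp (-(1 / 144) * ∑ t, excess a b v t ^ 2)) ≤
        ENNReal.ofReal |D| * ENNReal.ofReal (∏ i, q i (a.mulVec v (φ i))) := by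
    rw [← ENNReal.ofReal_mul (abs_nonneg D)]
    apply ENNReal.ofReal_le_ofReal
    rw [mul_assoc]
    simp only [hq, Finset.prod_mul_distrib]
    gcongr
    rw [← Real.exp_sum, Real.exp_le_exp, ← Finset.mul_sum]
    have hsub : ∑ i, excess a b v (φ i) ^ 2 ≤ ∑ t, excess a b v t ^ 2 := by
      rw [← Finset.sum_image (f := fun t => excess a b v t ^ 2) (s := Finset.univ) hφ.injOn]
      exact Finset.sum_le_sum_of_subset_of_nonneg (Finset.subset_univ _)
        fun _ _ _ => sq_nonneg _
    simp only [excess] at hsub ⊢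
    linarith
  calc _ ≤ ∫⁻ v : Fin k → ℝ,
          ENNReal.ofReal |D| * ENNReal.ofReal (∏ i, q i (a.mulVec v (φ i))) :=
        lintegral_mono hpt
    _ = ENNReal.ofReal |D| *
          ∫⁻ v : Fin k → ℝ, ENNReal.ofReal (∏ i, q i ((a.submatrix φ id).toLin' v i)) := by
        rw [lintegral_const_mul']
        · rfl
        · simp
    _ = ENNReal.ofReal |D| * (ENNReal.ofReal |D⁻¹| *
          ∫⁻ y : Fin k → ℝ, ENNReal.ofReal (∏ i, q i (y i))) := by
        have hmap := Real.map_matrix_volume_pi_eq_smul_volume_pi (M := a.submatrix φ id) hdet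
        have hmeas : Measurable (Matrix.toLin' (a.submatrix φ id)) :=
          (LinearMap.continuous_of_finiteDimensional _).measurable
        rw [← lintegral_map (f := fun y : Fin k → ℝ => ENNReal.ofReal (∏ i, q i (y i)))
          hQmeas hmeas, hmap, lintegral_smul_measure, smul_eq_mul]
    _ = ENNReal.ofReal (∏ i, ∫ y, q i y) := by
        rw [← mul_assoc, ← ENNReal.ofReal_mul (abs_nonneg _), ← abs_mul, mul_inv_cancel₀ hdet,
          abs_one, ENNReal.ofReal_one, one_mul]
        exact lintegral_ofReal_prod_eval (fun _ => volume) q hq0 hqint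
    _ ≤ ENNReal.ofReal ((56 * √k) ^ k) := by
        apply ENNReal.ofReal_le_ofReal
        calc ∏ i, ∫ y, q i y ≤ ∏ _i : Fin k, 56 * √(k : ℝ) :=
              Finset.prod_le_prod (fun i _ => integral_nonneg (hq0 i))
                fun i _ => integral_sqrt_mul_exp_quartic_le hk (b (φ i))
          _ = _ := by simp

lemma lintegral_jeffreysMajorant_mul_exp_le {n k : ℕ} (hk : 0 < k)
    (a : Matrix (Fin n) (Fin k) ℝ) (b : Fin n → ℝ) :
    ∫⁻ v : Fin k → ℝ, ENNReal.ofReal (jeffreysMajorant a v *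
        Real.exp (-(1 / 144) * ∑ t, excess a b v t ^ 2)) ≤
      ENNReal.ofReal ((n * (56 * √k)) ^ k / k.factorial) := by
  have hexp (v : Fin k → ℝ) : ENNReal.ofReal (jeffreysMajorant a v *
        Real.exp (-(1 / 144) * ∑ t, excess a b v t ^ 2)) =
      ENNReal.ofReal ((k.factorial : ℝ)⁻¹) * ∑ φ : Fin k → Fin n,
        ENNReal.ofReal (|(a.submatrix φ id).det| * (∏ i, √(4 * (a.mulVec v (φ i)) ^ 2 + k)) *
          Real.exp (-(1 / 144) * ∑ t, excess a b v t ^ 2)) := by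
    rw [← ENNReal.ofReal_sum_of_nonneg fun φ _ => by positivity,
      ← ENNReal.ofReal_mul (by positivity), ← Finset.sum_mul, jeffreysMajorant]
    congr 1
    ring
  simp_rw [hexp]
  rw [lintegral_const_mul' _ _ (by simp), lintegral_finsetSum]
  · calc _ ≤ ENNReal.ofReal ((k.factorial : ℝ)⁻¹) *
          ∑ _φ : Fin k → Fin n, ENNReal.ofReal ((56 * √k) ^ k) := by
          gcongr with φ
          exact lintegral_minor_mul_exp_le hk a b φ
      _ = _ := by
          rw [← ENNReal.ofReal_sum_of_nonneg fun φ _ => by positivity,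
            ← ENNReal.ofReal_mul (by positivity)]
          congr 1
          simp only [Finset.sum_const, Finset.card_univ, Fintype.card_fun, Fintype.card_fin,
            nsmul_eq_mul, Nat.cast_pow]
          ring
  · intro φ _
    have h1 := continuous_mulVec_apply a
    have h2 := continuous_excess a b
    exact Continuous.measurable (by fun_prop) |>.ennreal_ofReal

/-- Squared Frobenius norm of `∑ₜ η_t a_t a_tᵀ`. -/
noncomputable def noiseEnergy {n k : ℕ} (a : Matrix (Fin n) (Fin k) ℝ) (η : Fin n → ℝ) : ℝ :=
  ∑ i, ∑ j, (∑ t, (a t i * a t j) * η t) ^ 2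

/-- Log-likelihood ratio of signal strength `1 / 2`, with an extra quadratic penalty. -/
noncomputable def tiltedLogLik {n k : ℕ} (a : Matrix (Fin n) (Fin k) ℝ) (b η : Fin n → ℝ)
    (v : Fin k → ℝ) : ℝ :=
  (1 / 2) * ∑ t, excess a b v t * η t - (19 / 144) * ∑ t, excess a b v t ^ 2

/-- The integrand of the exponential supermartingale mixture. -/
noncomputable def mixtureDensity {n k : ℕ} (a : Matrix (Fin n) (Fin k) ℝ) (b η : Fin n → ℝ)
    (v : Fin k → ℝ) : ℝ :=
  jeffreysMajorant a v * Real.exp (tiltedLogLik a b η v)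

lemma sum_sq_mulVec {m n : Type*} [Fintype m] [Fintype n]
    (X : Matrix m n ℝ) (r : n → ℝ) :
    ∑ t, (X.mulVec r t) ^ 2 = r ⬝ᵥ ((X.transpose * X).mulVec r) := by
  rw [← Matrix.mulVec_mulVec, Matrix.dotProduct_mulVec, Matrix.vecMul_transpose]
  simp [dotProduct, sq]

lemma exists_sqrt_information {n k : ℕ} (hk : 0 < k) (a : Matrix (Fin n) (Fin k) ℝ)
    (ha : a.transpose * a = 1) (v : Fin k → ℝ) :
    ∃ B : Matrix (Fin k) (Fin k) ℝ, B.det ≠ 0 ∧ |B.det| ≤ jeffreysMajorant a v ∧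
      ∀ r, ∑ i, (B.mulVec r i) ^ 2 =
        ∑ t, (4 * (a.mulVec v t) ^ 2 + k) * (a.mulVec r t) ^ 2 := by
  set w : Fin n → ℝ := fun t => √(4 * (a.mulVec v t) ^ 2 + k) with hw
  set X : Matrix (Fin n) (Fin k) ℝ := Matrix.of fun t i => w t * a t i with hX
  obtain ⟨B, hB⟩ : ∃ B : Matrix (Fin k) (Fin k) ℝ, X.transpose * X = B.transpose * B := by
    open scoped MatrixOrder ComplexOrder Matrix.Norms.L2Operator in
    obtain ⟨B, hB⟩ := CStarAlgebra.nonneg_iff_eq_star_mul_self.mp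
      (Matrix.posSemidef_conjTranspose_mul_self X).nonneg
    exact ⟨B, by simpa [Matrix.star_eq_conjTranspose] using hB⟩
  have hnorm (r : Fin k → ℝ) : ∑ i, (B.mulVec r i) ^ 2 =
      ∑ t, (4 * (a.mulVec v t) ^ 2 + k) * (a.mulVec r t) ^ 2 := by
    rw [sum_sq_mulVec, ← hB, ← sum_sq_mulVec]
    refine Finset.sum_congr rfl fun t _ => ?_
    have hXt : X.mulVec r t = w t * a.mulVec r t := by
      simp only [hX, Matrix.mulVec, dotProduct, Matrix.of_apply, Finset.mul_sum, mul_assoc]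
    rw [hXt, mul_pow, hw, Real.sq_sqrt (by positivity)]
  refine ⟨B, fun hdet => ?_, ?_, hnorm⟩
  · obtain ⟨r, hr0, hr⟩ := Matrix.exists_mulVec_eq_zero_iff.2 hdet
    have h0 := hnorm r
    simp only [hr, Pi.zero_apply, ne_eq, OfNat.ofNat_ne_zero, not_false_eq_true, zero_pow,
      Finset.sum_const_zero] at h0
    have hkpos : (0 : ℝ) < k := by exact_mod_cast hk
    have hzero := (Finset.sum_eq_zero_iff_of_nonneg fun t _ => by positivity).1 h0.symm
    have har : a.mulVec r = 0 := by
      ext t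
      have := hzero t (Finset.mem_univ t)
      have hpos : 0 < 4 * (a.mulVec v t) ^ 2 + k := by positivity
      simpa [hpos.ne'] using this
    apply hr0
    rw [← Matrix.one_mulVec r, ← ha, ← Matrix.mulVec_mulVec, har, Matrix.mulVec_zero]
  · have hle := det_transpose_mul_self_le X
    rw [hB, Matrix.det_mul, Matrix.det_transpose, ← sq, Fintype.card_fin] at hle
    refine (abs_le_of_sq_le_sq hle (by positivity)).trans_eq ?_
    unfold jeffreysMajorant
    congr 1
    refine Finset.sum_congr rfl fun φ _ => ?_
    have hsub : X.submatrix φ id =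
        Matrix.of fun i j => w (φ i) * (a.submatrix φ id) i j := rfl
    rw [hsub, Matrix.det_mul_column, abs_mul, abs_of_nonneg (by positivity), mul_comm]

lemma jeffreysMajorant_add_ge {n k : ℕ} (hk : 0 < k) (a : Matrix (Fin n) (Fin k) ℝ)
    (v r : Fin k → ℝ) (hr : ∀ t, (a.mulVec r t) ^ 2 ≤ 1 / 9) :
    (7 / 10) ^ k * jeffreysMajorant a v ≤ jeffreysMajorant a (v + r) := by
  have hk1 : (1 : ℝ) ≤ k := by exact_mod_cast hk
  have hw (t : Fin n) : 7 / 10 * √(4 * (a.mulVec v t) ^ 2 + k) ≤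
      √(4 * (a.mulVec (v + r) t) ^ 2 + k) := by
    apply Real.le_sqrt_of_sq_le
    rw [mul_pow, Real.sq_sqrt (by positivity), Matrix.mulVec_add, Pi.add_apply]
    nlinarith [hr t, sq_nonneg (a.mulVec v t + 2 * a.mulVec r t)]
  unfold jeffreysMajorant
  rw [mul_div_assoc', Finset.mul_sum]
  refine div_le_div_of_nonneg_right (Finset.sum_le_sum fun φ _ => ?_) (by positivity)
  calc (7 / 10) ^ k * (|(a.submatrix φ id).det| * ∏ i, √(4 * (a.mulVec v (φ i)) ^ 2 + k))
      = |(a.submatrix φ id).det| * ∏ i, (7 / 10 * √(4 * (a.mulVec v (φ i)) ^ 2 + k)) := by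
        rw [Finset.prod_mul_distrib]
        simp only [Finset.prod_const, Finset.card_univ, Fintype.card_fin]
        ring
    _ ≤ _ := by
        gcongr with i
        exact hw (φ i)

lemma sum_sq_mulVec_mul_ge {n k : ℕ} (a : Matrix (Fin n) (Fin k) ℝ) (η : Fin n → ℝ)
    (r : Fin k → ℝ) (hr : ∑ i, r i ^ 2 ≤ 1 / 9) :
    -(1 + noiseEnergy a η) / 18 ≤ ∑ t, (a.mulVec r t) ^ 2 * η t := by
  have hquad : ∑ t, (a.mulVec r t) ^ 2 * η t =
      ∑ i, ∑ j, (r i * r j) * ∑ t, (a t i * a t j) * η t := by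
    simp_rw [Finset.mul_sum]
    simp_rw [Finset.sum_comm (s := Finset.univ (α := Fin k)) (t := Finset.univ (α := Fin n))]
    refine Finset.sum_congr rfl fun t _ => ?_
    simp only [Matrix.mulVec, dotProduct]
    rw [sq, Finset.sum_mul_sum, Finset.sum_mul]
    refine Finset.sum_congr rfl fun i _ => ?_
    rw [Finset.sum_mul]
    exact Finset.sum_congr rfl fun j _ => by ring
  have hterm (i j : Fin k) :
      -(9 / 2) * (r i ^ 2 * r j ^ 2) - (1 / 18) * (∑ t, (a t i * a t j) * η t) ^ 2 ≤
        (r i * r j) * ∑ t, (a t i * a t j) * η t := by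
    nlinarith [sq_nonneg (9 * (r i * r j) + ∑ t, (a t i * a t j) * η t)]
  have hsum : ∑ i, ∑ j, (-(9 / 2) * (r i ^ 2 * r j ^ 2) -
      (1 / 18) * (∑ t, (a t i * a t j) * η t) ^ 2) =
      -(9 / 2) * (∑ i, r i ^ 2) ^ 2 - (1 / 18) * noiseEnergy a η := by
    simp only [Finset.sum_sub_distrib, ← Finset.mul_sum, noiseEnergy]
    rw [sq (∑ i, r i ^ 2), Finset.sum_mul]
  have hr0 : 0 ≤ ∑ i, r i ^ 2 := Finset.sum_nonneg fun i _ => sq_nonneg _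
  rw [hquad]
  calc _ ≤ -(9 / 2) * (∑ i, r i ^ 2) ^ 2 - (1 / 18) * noiseEnergy a η := by nlinarith
    _ = _ := hsum.symm
    _ ≤ _ := Finset.sum_le_sum fun i _ => Finset.sum_le_sum fun j _ => hterm i j

/-- Lower bound, up to an entropy factor, of the mixture by its value near `v`. -/
noncomputable def localLogMass {n k : ℕ} (a : Matrix (Fin n) (Fin k) ℝ) (b η : Fin n → ℝ)
    (v : Fin k → ℝ) : ℝ :=
  (1 / 2) * ∑ t, excess a b v t * η t -
    (19 / 144) * ((21 / 20) * ∑ t, excess a b v t ^ 2 + 7 / 27 + (k : ℝ) / 9) -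
    (1 + noiseEnergy a η) / 36

lemma localLogMass_le_tiltedLogLik {n k : ℕ} (a : Matrix (Fin n) (Fin k) ℝ)
    (ha : a.transpose * a = 1) (b η : Fin n → ℝ) (v r : Fin k → ℝ)
    (hr : ∑ t, (a.mulVec r t) ^ 2 ≤ 1 / 9)
    (hvr : ∑ t, 4 * (a.mulVec v t) ^ 2 * (a.mulVec r t) ^ 2 ≤ (k : ℝ) / 9) :
    localLogMass a b η v ≤ (tiltedLogLik a b η (v + r) + tiltedLogLik a b η (v - r)) / 2 := by
  have hr' : ∑ i, r i ^ 2 ≤ 1 / 9 := by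
    rw [sum_sq_mulVec, ha, Matrix.one_mulVec] at hr
    simpa [dotProduct, sq] using hr
  have hnoise := sum_sq_mulVec_mul_ge a η r hr'
  have hfour : ∑ t, (a.mulVec r t) ^ 4 ≤ 1 / 81 := by
    calc ∑ t, (a.mulVec r t) ^ 4 = ∑ t, ((a.mulVec r t) ^ 2) ^ 2 := by
          simp only [← pow_mul]
      _ ≤ (∑ t, (a.mulVec r t) ^ 2) ^ 2 :=
          Finset.sum_sq_le_sq_sum_of_nonneg fun t _ => sq_nonneg _
      _ ≤ (1 / 9) ^ 2 := by gcongr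
      _ = 1 / 81 := by norm_num
  have hlin : ∑ t, excess a b (v + r) t * η t + ∑ t, excess a b (v - r) t * η t =
      2 * ∑ t, excess a b v t * η t + 2 * ∑ t, (a.mulVec r t) ^ 2 * η t := by
    simp only [Finset.mul_sum, ← Finset.sum_add_distrib]
    refine Finset.sum_congr rfl fun t _ => ?_
    simp only [excess, Matrix.mulVec_add, Matrix.mulVec_sub, Pi.add_apply, Pi.sub_apply]
    ring
  have hquad : ∑ t, excess a b (v + r) t ^ 2 + ∑ t, excess a b (v - r) t ^ 2 ≤
      2 * ((21 / 20) * ∑ t, excess a b v t ^ 2 + 21 * ∑ t, (a.mulVec r t) ^ 4 +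
        ∑ t, 4 * (a.mulVec v t) ^ 2 * (a.mulVec r t) ^ 2) := by
    simp only [Finset.mul_sum, ← Finset.sum_add_distrib]
    refine Finset.sum_le_sum fun t _ => ?_
    simp only [excess, Matrix.mulVec_add, Matrix.mulVec_sub, Pi.add_apply, Pi.sub_apply]
    nlinarith [sq_nonneg ((a.mulVec v t ^ 2 - b t) - 20 * a.mulVec r t ^ 2)]
  unfold localLogMass tiltedLogLik
  linarith

lemma le_mixtureDensity_add {n k : ℕ} (hk : 0 < k) (a : Matrix (Fin n) (Fin k) ℝ)
    (ha : a.transpose * a = 1) (b η : Fin n → ℝ) (v r : Fin k → ℝ)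
    (hr : ∑ t, (4 * (a.mulVec v t) ^ 2 + k) * (a.mulVec r t) ^ 2 ≤ (k : ℝ) / 9) :
    2 * ((7 / 10) ^ k * jeffreysMajorant a v * Real.exp (localLogMass a b η v)) ≤
      mixtureDensity a b η (v + r) + mixtureDensity a b η (v - r) := by
  have hkpos : (0 : ℝ) < k := by exact_mod_cast hk
  have hsplit : ∑ t, (4 * (a.mulVec v t) ^ 2 + k) * (a.mulVec r t) ^ 2 =
      ∑ t, 4 * (a.mulVec v t) ^ 2 * (a.mulVec r t) ^ 2 + k * ∑ t, (a.mulVec r t) ^ 2 := by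
    rw [Finset.mul_sum, ← Finset.sum_add_distrib]
    exact Finset.sum_congr rfl fun t _ => by ring
  have hA : 0 ≤ ∑ t, 4 * (a.mulVec v t) ^ 2 * (a.mulVec r t) ^ 2 :=
    Finset.sum_nonneg fun t _ => by positivity
  have hR : 0 ≤ ∑ t, (a.mulVec r t) ^ 2 := Finset.sum_nonneg fun t _ => sq_nonneg _
  have hR9 : ∑ t, (a.mulVec r t) ^ 2 ≤ 1 / 9 := by
    refine le_of_mul_le_mul_left ?_ hkpos
    linarith
  have hpt (t : Fin n) : (a.mulVec r t) ^ 2 ≤ 1 / 9 :=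
    (Finset.single_le_sum (f := fun t => (a.mulVec r t) ^ 2) (fun t _ => sq_nonneg _)
      (Finset.mem_univ t)).trans hR9
  have hJ := jeffreysMajorant_add_ge hk a v r hpt
  have hJ' := jeffreysMajorant_add_ge hk a v (-r) (by simpa [Matrix.mulVec_neg] using hpt)
  rw [← sub_eq_add_neg] at hJ'
  have hL := localLogMass_le_tiltedLogLik a ha b η v r hR9
    (by nlinarith [mul_nonneg hkpos.le hR])
  have hexp : 2 * Real.exp (localLogMass a b η v) ≤
      Real.exp (tiltedLogLik a b η (v + r)) + Real.exp (tiltedLogLik a b η (v - r)) := by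
    set x := tiltedLogLik a b η (v + r)
    set y := tiltedLogLik a b η (v - r)
    have hmid : Real.exp (localLogMass a b η v) ≤ Real.exp (x / 2) * Real.exp (y / 2) := by
      rw [← Real.exp_add]
      exact Real.exp_le_exp.2 (by linarith)
    have hx : Real.exp x = Real.exp (x / 2) ^ 2 := by
      rw [← Real.exp_nat_mul]
      congr 1
      push_cast
      ring
    have hy : Real.exp y = Real.exp (y / 2) ^ 2 := by
      rw [← Real.exp_nat_mul]
      congr 1
      push_cast
      ring
    nlinarith [sq_nonneg (Real.exp (x / 2) - Real.exp (y / 2))]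
  have hJ0 : 0 ≤ (7 / 10) ^ k * jeffreysMajorant a v :=
    mul_nonneg (by positivity) (jeffreysMajorant_nonneg a v)
  unfold mixtureDensity
  calc 2 * ((7 / 10) ^ k * jeffreysMajorant a v * Real.exp (localLogMass a b η v))
      = ((7 / 10) ^ k * jeffreysMajorant a v) * (2 * Real.exp (localLogMass a b η v)) := by ring
    _ ≤ ((7 / 10) ^ k * jeffreysMajorant a v) * (Real.exp (tiltedLogLik a b η (v + r)) +
          Real.exp (tiltedLogLik a b η (v - r))) := by gcongr
    _ ≤ _ := by
        rw [mul_add]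
        gcongr

lemma continuous_mixtureDensity {n k : ℕ} (a : Matrix (Fin n) (Fin k) ℝ) (b η : Fin n → ℝ) :
    Continuous (mixtureDensity a b η) := by
  have h1 := continuous_excess a b
  have h2 := continuous_jeffreysMajorant a
  unfold mixtureDensity tiltedLogLik
  fun_prop

lemma mixtureDensity_nonneg {n k : ℕ} (a : Matrix (Fin n) (Fin k) ℝ) (b η : Fin n → ℝ)
    (v : Fin k → ℝ) : 0 ≤ mixtureDensity a b η v :=
  mul_nonneg (jeffreysMajorant_nonneg a v) (Real.exp_pos _).le

lemma exp_localLogMass_le_lintegral {n k : ℕ} (hk : 0 < k) (a : Matrix (Fin n) (Fin k) ℝ)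
    (ha : a.transpose * a = 1) (b η : Fin n → ℝ) (v : Fin k → ℝ) :
    ENNReal.ofReal ((7 / 15) ^ k * Real.exp (localLogMass a b η v)) ≤
      ∫⁻ v', ENNReal.ofReal (mixtureDensity a b η v') := by
  obtain ⟨B, hdet, hBJ, hB⟩ := exists_sqrt_information hk a ha v
  set H : (Fin k → ℝ) → ENNReal := fun v' => ENNReal.ofReal (mixtureDensity a b η v') with hH
  have hHmeas : Measurable H := (continuous_mixtureDensity a b η).measurable.ennreal_ofReal
  set W := ∫⁻ v', H v' with hW
  have hBunit : IsUnit B.det := isUnit_iff_ne_zero.2 hdet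
  have hinvdet : (B⁻¹).det ≠ 0 := by
    rw [Matrix.det_nonsing_inv, Ring.inverse_eq_inv']
    exact inv_ne_zero hdet
  have hlinmeas : Measurable (Matrix.toLin' B⁻¹) :=
    (LinearMap.continuous_of_finiteDimensional _).measurable
  have hmap := Real.map_matrix_volume_pi_eq_smul_volume_pi hinvdet
  have hchange (F : (Fin k → ℝ) → ENNReal) (hF : Measurable F) :
      ∫⁻ u, F (B⁻¹.mulVec u) = ENNReal.ofReal |B.det| * ∫⁻ r, F r := by
    have : ∫⁻ u, F (Matrix.toLin' B⁻¹ u) = ENNReal.ofReal |B.det| * ∫⁻ r, F r := by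
      rw [← lintegral_map hF hlinmeas, hmap, lintegral_smul_measure, smul_eq_mul,
        Matrix.det_nonsing_inv, Ring.inverse_eq_inv', inv_inv]
    simpa only [Matrix.toLin'_apply] using this
  have hplus : ∫⁻ u, H (v + B⁻¹.mulVec u) = ENNReal.ofReal |B.det| * W := by
    rw [hchange (fun r => H (v + r)) (hHmeas.comp (measurable_const_add v)),
      lintegral_add_left_eq_self H v]
  have hminus : ∫⁻ u, H (v - B⁻¹.mulVec u) = ENNReal.ofReal |B.det| * W := by
    rw [hchange (fun r => H (v - r)) (hHmeas.comp (measurable_const_sub v)),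
      lintegral_sub_left_eq_self H v]
  set Q : Set (Fin k → ℝ) := Set.Icc (fun _ => -(1 / 3)) (fun _ => 1 / 3) with hQ
  have hQvol : volume Q = ENNReal.ofReal ((2 / 3) ^ k) := by
    rw [hQ, Real.volume_Icc_pi, ENNReal.ofReal_pow (by norm_num)]
    norm_num
  set c := (7 / 10) ^ k * |B.det| * Real.exp (localLogMass a b η v) with hc
  have hpoint : ∀ u ∈ Q, ENNReal.ofReal (2 * c) ≤
      H (v + B⁻¹.mulVec u) + H (v - B⁻¹.mulVec u) := by
    intro u hu
    rw [hH, ← ENNReal.ofReal_add (mixtureDensity_nonneg _ _ _ _) (mixtureDensity_nonneg _ _ _ _)]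
    apply ENNReal.ofReal_le_ofReal
    refine le_trans ?_ (le_mixtureDensity_add hk a ha b η v (B⁻¹.mulVec u) ?_)
    · rw [hc]
      gcongr
    · rw [← hB, Matrix.mulVec_mulVec, Matrix.mul_nonsing_inv B hBunit, Matrix.one_mulVec]
      calc ∑ i, u i ^ 2 ≤ ∑ _i : Fin k, (1 / 9 : ℝ) := by
            refine Finset.sum_le_sum fun i _ => ?_
            have h1 : -(1 / 3) ≤ u i := hu.1 i
            have h2 : u i ≤ 1 / 3 := hu.2 i
            nlinarith
        _ = k / 9 := by simp; ring
  have hmain : ENNReal.ofReal (2 * c) * ENNReal.ofReal ((2 / 3) ^ k) ≤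
      2 * (ENNReal.ofReal |B.det| * W) := by
    calc _ = ∫⁻ _u in Q, ENNReal.ofReal (2 * c) := by rw [setLIntegral_const, hQvol]
      _ ≤ ∫⁻ u in Q, (H (v + B⁻¹.mulVec u) + H (v - B⁻¹.mulVec u)) :=
          setLIntegral_mono' measurableSet_Icc hpoint
      _ ≤ ∫⁻ u, (H (v + B⁻¹.mulVec u) + H (v - B⁻¹.mulVec u)) := setLIntegral_le_lintegral _ _
      _ = _ := by
          rw [lintegral_add_left, hplus, hminus, two_mul]
          exact hHmeas.comp ((measurable_const_add v).comp hlinmeas)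
  have hD : 0 < |B.det| := abs_pos.2 hdet
  have h2D : ENNReal.ofReal (2 * |B.det|) ≠ 0 := by
    simpa using hD
  refine (ENNReal.mul_le_mul_iff_right h2D ENNReal.ofReal_ne_top).1 ?_
  rw [← ENNReal.ofReal_mul (by positivity)]
  calc _ = ENNReal.ofReal (2 * c) * ENNReal.ofReal ((2 / 3) ^ k) := by
        rw [← ENNReal.ofReal_mul (by positivity), hc,
          show (7 / 15 : ℝ) = (7 / 10) * (2 / 3) by norm_num, mul_pow]
        congr 1
        ring
    _ ≤ 2 * (ENNReal.ofReal |B.det| * W) := hmain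
    _ = _ := by
        rw [ENNReal.ofReal_mul (by norm_num), ENNReal.ofReal_ofNat, mul_assoc]

lemma continuous_mixtureDensity_prod {n k : ℕ} (a : Matrix (Fin n) (Fin k) ℝ) (b : Fin n → ℝ) :
    Continuous fun p : (Fin n → ℝ) × (Fin k → ℝ) => mixtureDensity a b p.1 p.2 := by
  have h1 := continuous_excess a b
  have h2 := continuous_jeffreysMajorant a
  unfold mixtureDensity tiltedLogLik
  fun_prop

lemma lintegral_lintegral_mixtureDensity_le {n k : ℕ} (hk : 0 < k) (a : Matrix (Fin n) (Fin k) ℝ)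
    (b : Fin n → ℝ) :
    ∫⁻ η, (∫⁻ v, ENNReal.ofReal (mixtureDensity a b η v))
        ∂(Measure.pi fun _ : Fin n => gaussianReal 0 1) ≤
      ENNReal.ofReal ((n * (56 * √k)) ^ k / k.factorial) := by
  rw [lintegral_lintegral_swap (continuous_mixtureDensity_prod a b).measurable.ennreal_ofReal.aemeasurable]
  refine le_trans (le_of_eq (lintegral_congr fun v => ?_))
    (lintegral_jeffreysMajorant_mul_exp_le hk a b)
  have hfactor (η : Fin n → ℝ) : mixtureDensity a b η v =
      (jeffreysMajorant a v * Real.exp (-(19 / 144) * ∑ t, excess a b v t ^ 2)) *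
        Real.exp (∑ t, (1 / 2 * excess a b v t) * η t) := by
    rw [mixtureDensity, tiltedLogLik, mul_assoc, ← Real.exp_add]
    simp only [mul_assoc, ← Finset.mul_sum]
    congr 2
    ring
  have hJ := jeffreysMajorant_nonneg a v
  simp_rw [hfactor]
  simp_rw [ENNReal.ofReal_mul (mul_nonneg hJ (Real.exp_pos _).le)]
  rw [lintegral_const_mul' _ _ ENNReal.ofReal_ne_top, lintegral_exp_linear_pi_gaussianReal,
    ← ENNReal.ofReal_mul (mul_nonneg hJ (Real.exp_pos _).le), mul_assoc, ← Real.exp_add]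
  congr 3
  simp only [mul_pow, ← Finset.mul_sum]
  ring

lemma sum_sq_row_le_one {n k : ℕ} (a : Matrix (Fin n) (Fin k) ℝ) (ha : a.transpose * a = 1)
    (t : Fin n) : ∑ i, a t i ^ 2 ≤ 1 := by
  have h := sum_sq_mulVec a fun i => a t i
  rw [ha, Matrix.one_mulVec] at h
  have hrow : a.mulVec (fun i => a t i) t = ∑ i, a t i ^ 2 := by simp [Matrix.mulVec, dotProduct, sq]
  have hle : (a.mulVec (fun i => a t i) t) ^ 2 ≤ ∑ s, (a.mulVec (fun i => a t i) s) ^ 2 :=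
    Finset.single_le_sum (f := fun s => (a.mulVec (fun i => a t i) s) ^ 2)
      (fun s _ => sq_nonneg _) (Finset.mem_univ t)
  have hdot : (fun i => a t i) ⬝ᵥ (fun i => a t i) = ∑ i, a t i ^ 2 := by simp [dotProduct, sq]
  rw [h, hrow, hdot] at hle
  have h0 : 0 ≤ ∑ i, a t i ^ 2 := Finset.sum_nonneg fun i _ => sq_nonneg _
  nlinarith

lemma integrable_noiseEnergy {n k : ℕ} (a : Matrix (Fin n) (Fin k) ℝ) :
    Integrable (noiseEnergy a) (Measure.pi fun _ : Fin n => gaussianReal 0 1) :=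
  integrable_finsetSum _ fun i _ => integrable_finsetSum _ fun j _ =>
    (integrable_sq_linear_pi_gaussianReal fun t => a t i * a t j).1

lemma integral_noiseEnergy_le {n k : ℕ} (a : Matrix (Fin n) (Fin k) ℝ)
    (ha : a.transpose * a = 1) :
    ∫ η, noiseEnergy a η ∂(Measure.pi fun _ : Fin n => gaussianReal 0 1) ≤ k := by
  have hint (i j : Fin k) := integrable_sq_linear_pi_gaussianReal fun t => a t i * a t j
  have heq : ∫ η, noiseEnergy a η ∂(Measure.pi fun _ : Fin n => gaussianReal 0 1) =
      ∑ i, ∑ j, ∑ t, (a t i * a t j) ^ 2 := by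
    unfold noiseEnergy
    rw [integral_finsetSum _ fun i _ => integrable_finsetSum _ fun j _ => (hint i j).1]
    refine Finset.sum_congr rfl fun i _ => ?_
    rw [integral_finsetSum _ fun j _ => (hint i j).1]
    exact Finset.sum_congr rfl fun j _ => (hint i j).2
  have htrace : ∑ i, ∑ t, a t i ^ 2 = k := by
    have : ∀ i, ∑ t, a t i ^ 2 = 1 := fun i => by
      have := congrFun (congrFun ha i) i
      simpa [Matrix.mul_apply, sq] using this
    simp [this]
  rw [heq, ← htrace]
  refine Finset.sum_le_sum fun i _ => ?_
  rw [Finset.sum_comm]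
  refine Finset.sum_le_sum fun t _ => ?_
  simp only [mul_pow, ← Finset.mul_sum]
  exact mul_le_of_le_one_right (sq_nonneg _) (sum_sq_row_le_one a ha t)

lemma pow_self_le_factorial_sq (k : ℕ) :
    (33 / 20 : ℝ) ^ k * (k : ℝ) ^ k ≤ 6 * (k.factorial : ℝ) ^ 2 := by
  rcases lt_or_ge k 4 with hk | hk
  · interval_cases k <;> norm_num [Nat.factorial]
  · induction k, hk using Nat.le_induction with
    | base => norm_num [Nat.factorial]
    | succ k hk ih =>
      have hk4 : (4 : ℝ) ≤ k := by exact_mod_cast hk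
      have hk0 : (0 : ℝ) < k := by linarith
      have he : ((k : ℝ) + 1) ^ k ≤ (k : ℝ) ^ k * Real.exp 1 := by
        have h := pow_le_pow_left₀ (by positivity) (Real.add_one_le_exp (1 / (k : ℝ))) k
        rw [← Real.exp_nat_mul, mul_one_div_cancel hk0.ne'] at h
        calc ((k : ℝ) + 1) ^ k = (k : ℝ) ^ k * (1 / (k : ℝ) + 1) ^ k := by
              rw [← mul_pow, mul_add, mul_one_div_cancel hk0.ne', mul_one, add_comm]
          _ ≤ _ := by gcongr
      have he' := Real.exp_one_lt_d9
      have hstep : (33 / 20) * Real.exp 1 ≤ (k : ℝ) + 1 := by linarith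
      rw [Nat.factorial_succ]
      push_cast
      calc (33 / 20 : ℝ) ^ (k + 1) * ((k : ℝ) + 1) ^ (k + 1)
          = ((33 / 20 : ℝ) ^ k * ((k : ℝ) + 1) ^ k) * ((33 / 20) * ((k : ℝ) + 1)) := by ring
        _ ≤ ((33 / 20 : ℝ) ^ k * ((k : ℝ) ^ k * Real.exp 1)) * ((33 / 20) * ((k : ℝ) + 1)) := by
            gcongr
        _ = ((33 / 20 : ℝ) ^ k * (k : ℝ) ^ k) * (((33 / 20) * Real.exp 1) * ((k : ℝ) + 1)) := by
            ring
        _ ≤ (6 * (k.factorial : ℝ) ^ 2) * (((k : ℝ) + 1) * ((k : ℝ) + 1)) := by gcongr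
        _ = _ := by ring

lemma log_mixture_bound_le {n k : ℕ} (hn : 0 < n) (hk : 0 < k) :
    k * Real.log (15 / 7) + Real.log ((n * (56 * √k)) ^ k / k.factorial) +
      (19 / 144) * (7 / 27 + (k : ℝ) / 9) + (1 + (k : ℝ)) / 36 ≤
      1 + k * Real.log (98 * n) := by
  have hk0 : (0 : ℝ) < k := by exact_mod_cast hk
  have hn0 : (0 : ℝ) < n := by exact_mod_cast hn
  have hf0 : (0 : ℝ) < k.factorial := by exact_mod_cast k.factorial_pos
  have hs0 : 0 < √(k : ℝ) := Real.sqrt_pos.2 hk0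
  have hfac := Real.log_le_log (by positivity) (pow_self_le_factorial_sq k)
  rw [Real.log_mul (by positivity) (by positivity), Real.log_mul (by positivity) (by positivity),
    Real.log_pow, Real.log_pow, Real.log_pow] at hfac
  have hsix : Real.log 6 ≤ 3 * Real.log 2 - 1 / 4 := by
    rw [show (6 : ℝ) = 2 ^ 3 * (3 / 4) by norm_num,
      Real.log_mul (by positivity) (by positivity), Real.log_pow]
    have := Real.log_le_sub_one_of_pos (show (0 : ℝ) < 3 / 4 by norm_num)
    push_cast
    linarith
  have hratio : 2 * (Real.log (15 / 7) + Real.log 56) - 2 * Real.log 98 -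
      Real.log (33 / 20) ≤ (60 / 49) ^ 2 * (20 / 33) - 1 := by
    rw [← Real.log_mul (by norm_num) (by norm_num)]
    have h := Real.log_le_sub_one_of_pos (show (0 : ℝ) < (60 / 49) ^ 2 * (20 / 33) by norm_num)
    have heq : Real.log ((60 / 49) ^ 2 * (20 / 33)) =
        2 * Real.log (15 / 7 * 56) - 2 * Real.log 98 - Real.log (33 / 20) := by
      rw [show ((60 / 49) ^ 2 * (20 / 33) : ℝ) = (15 / 7 * 56) ^ 2 / 98 ^ 2 / (33 / 20) by norm_num,
        Real.log_div (by norm_num) (by norm_num), Real.log_div (by norm_num) (by norm_num),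
        Real.log_pow, Real.log_pow]
      push_cast
      ring
    linarith
  have hlog2 := Real.log_two_lt_d9
  rw [Real.log_div (by positivity) hf0.ne', Real.log_pow, Real.log_mul hn0.ne' (by positivity),
    Real.log_mul (by norm_num) hs0.ne', Real.log_sqrt hk0.le,
    Real.log_mul (by norm_num) hn0.ne']
  push_cast at hfac
  nlinarith [mul_le_mul_of_nonneg_left hratio hk0.le]

lemma integral_sum_sq_excess_le {n k : ℕ} (hn : 0 < n) (hk : 0 < k) {Ω : Type*}
    [MeasurableSpace Ω] (μ : Measure Ω) [IsProbabilityMeasure μ] (η : Ω → Fin n → ℝ)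
    (hη : Measure.map η μ = Measure.pi fun _ : Fin n => gaussianReal 0 1)
    (a : Matrix (Fin n) (Fin k) ℝ) (ha : a.transpose * a = 1) (b : Fin n → ℝ)
    (v : Ω → Fin k → ℝ)
    (hv : ∀ ω, ∑ t, excess a b (v ω) t ^ 2 ≤ 2 * ∑ t, excess a b (v ω) t * η ω t) :
    ∫ ω, ∑ t, excess a b (v ω) t ^ 2 ∂μ ≤ 9 * (1 + k * Real.log (98 * n)) := by
  have hk0 : (0 : ℝ) < k := by exact_mod_cast hk
  have hn0 : (0 : ℝ) < n := by exact_mod_cast hn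
  have hf0 : (0 : ℝ) < k.factorial := by exact_mod_cast k.factorial_pos
  have hs0 : 0 < √(k : ℝ) := Real.sqrt_pos.2 hk0
  have hηae : AEMeasurable η μ := by
    by_contra h
    rw [Measure.map_of_not_aemeasurable h] at hη
    exact IsProbabilityMeasure.ne_zero (Measure.pi fun _ : Fin n => gaussianReal 0 1) hη.symm
  by_cases hS : Integrable (fun ω => ∑ t, excess a b (v ω) t ^ 2) μ
  swap
  · rw [integral_undef hS]
    have h1 : (1 : ℝ) ≤ 98 * n := by
      have : (1 : ℝ) ≤ n := by exact_mod_cast hn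
      linarith
    have := Real.log_nonneg h1
    positivity
  have hnoise := integrable_noiseEnergy a
  have hnoise' := integral_noiseEnergy_le a ha
  rw [← hη] at hnoise hnoise'
  have hG : Integrable (fun ω => noiseEnergy a (η ω)) μ := hnoise.comp_aemeasurable hηae
  rw [integral_map hηae hnoise.aestronglyMeasurable] at hnoise'
  set Z : ℝ := (n * (56 * √k)) ^ k / k.factorial with hZ
  have hZ0 : 0 < Z := by positivity
  set C : ℝ := k * Real.log (15 / 7) + Real.log Z + (19 / 144) * (7 / 27 + (k : ℝ) / 9) + 1 / 36
    with hC
  set Y : Ω → ℝ := fun ω => (1 / 9) * ∑ t, excess a b (v ω) t ^ 2 -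
    (1 / 36) * noiseEnergy a (η ω) - C with hY
  have hYint : Integrable Y μ :=
    ((hS.const_mul _).sub (hG.const_mul _)).sub (integrable_const _)
  have hYle (ω : Ω) : ENNReal.ofReal (Real.exp (Y ω)) ≤
      ENNReal.ofReal Z⁻¹ * ∫⁻ v', ENNReal.ofReal (mixtureDensity a b (η ω) v') := by
    refine le_trans ?_ (mul_le_mul_right
      (exp_localLogMass_le_lintegral hk a ha b (η ω) (v ω)) _)
    rw [← ENNReal.ofReal_mul (by positivity)]
    apply ENNReal.ofReal_le_ofReal
    have h7 : (7 / 15 : ℝ) ^ k = Real.exp (-(k * Real.log (15 / 7))) := by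
      rw [← mul_neg, ← Real.log_inv, Real.exp_nat_mul, Real.exp_log (by norm_num)]
      norm_num
    have hZexp : Z⁻¹ = Real.exp (-Real.log Z) := by rw [Real.exp_neg, Real.exp_log hZ0]
    rw [h7, hZexp, ← Real.exp_add, ← Real.exp_add, Real.exp_le_exp, hY, hC, localLogMass]
    have hpos : 0 ≤ ∑ t, excess a b (v ω) t ^ 2 := Finset.sum_nonneg fun t _ => sq_nonneg _
    have := hv ω
    linarith
  have hmeas : Measurable fun η' : Fin n → ℝ =>
      ∫⁻ v', ENNReal.ofReal (mixtureDensity a b η' v') :=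
    (continuous_mixtureDensity_prod a b).measurable.ennreal_ofReal.lintegral_prod_right'
  have hone : ∫⁻ ω, ENNReal.ofReal (Real.exp (Y ω)) ∂μ ≤ 1 := by
    calc _ ≤ ∫⁻ ω, ENNReal.ofReal Z⁻¹ *
          (∫⁻ v', ENNReal.ofReal (mixtureDensity a b (η ω) v')) ∂μ := lintegral_mono hYle
      _ = ENNReal.ofReal Z⁻¹ *
          ∫⁻ ω, (∫⁻ v', ENNReal.ofReal (mixtureDensity a b (η ω) v')) ∂μ :=
        lintegral_const_mul' _ _ ENNReal.ofReal_ne_top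
      _ ≤ ENNReal.ofReal Z⁻¹ * ENNReal.ofReal Z := by
        gcongr
        rw [← lintegral_map' hmeas.aemeasurable hηae, hη]
        exact lintegral_lintegral_mixtureDensity_le hk a b
      _ = 1 := by
        rw [← ENNReal.ofReal_mul (by positivity), inv_mul_cancel₀ hZ0.ne', ENNReal.ofReal_one]
  have hexpmeas : AEStronglyMeasurable (fun ω => Real.exp (Y ω)) μ :=
    Real.continuous_exp.comp_aestronglyMeasurable hYint.aestronglyMeasurable
  have hexpnn : 0 ≤ᵐ[μ] fun ω => Real.exp (Y ω) := ae_of_all _ fun ω => (Real.exp_pos _).le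
  have hexpint : Integrable (fun ω => Real.exp (Y ω)) μ :=
    (lintegral_ofReal_ne_top_iff_integrable hexpmeas hexpnn).1
      (hone.trans_lt ENNReal.one_lt_top).ne
  have hEexp : ∫ ω, Real.exp (Y ω) ∂μ ≤ 1 := by
    rw [integral_eq_lintegral_of_nonneg_ae hexpnn hexpmeas]
    exact ENNReal.toReal_le_of_le_ofReal zero_le_one (by simpa using hone)
  have hEY : ∫ ω, (Y ω + 1) ∂μ ≤ ∫ ω, Real.exp (Y ω) ∂μ :=
    integral_mono (hYint.add (integrable_const _)) hexpint fun ω => Real.add_one_le_exp _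
  have hYeq : ∫ ω, Y ω ∂μ = (1 / 9) * ∫ ω, ∑ t, excess a b (v ω) t ^ 2 ∂μ -
      (1 / 36) * ∫ ω, noiseEnergy a (η ω) ∂μ - C := by
    have hsub : Integrable (fun ω => (1 / 9) * ∑ t, excess a b (v ω) t ^ 2 -
        (1 / 36) * noiseEnergy a (η ω)) μ := (hS.const_mul _).sub (hG.const_mul _)
    rw [integral_sub hsub (integrable_const _),
      integral_sub (hS.const_mul _) (hG.const_mul _), integral_const_mul, integral_const_mul]
    simp
  rw [integral_add hYint (integrable_const _), hYeq] at hEY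
  have hbound := log_mixture_bound_le hn hk
  simp only [integral_const, probReal_univ, smul_eq_mul, mul_one] at hEY
  rw [← hZ] at hbound
  linarith

lemma exists_orthonormal_coordinates {d n : ℕ} (A : Fin n → EuclideanSpace ℝ (Fin d)) (k : ℕ)
    (hk : Module.finrank ℝ (Submodule.span ℝ (Set.range A)) = k) :
    ∃ a : Matrix (Fin n) (Fin k) ℝ, a.transpose * a = 1 ∧
      ∀ θ, ∃ v, ∀ t, a.mulVec v t = ⟪A t, θ⟫ := by
  let T : EuclideanSpace ℝ (Fin d) →ₗ[ℝ] EuclideanSpace ℝ (Fin n) :=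
    { toFun := fun θ => WithLp.toLp 2 fun t => ⟪A t, θ⟫
      map_add' := fun x y => by ext t; simp [inner_add_right]
      map_smul' := fun c x => by ext t; simp [inner_smul_right] }
  have hker : T.ker = (Submodule.span ℝ (Set.range A))ᗮ := by
    ext θ
    rw [LinearMap.mem_ker, Submodule.mem_orthogonal]
    constructor
    · intro h u hu
      induction hu using Submodule.span_induction with
      | mem x hx =>
        obtain ⟨t, rfl⟩ := hx
        exact congrFun (congrArg WithLp.ofLp h) t
      | zero => exact inner_zero_left _
      | add x y _ _ hx hy => rw [inner_add_left, hx, hy, add_zero]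
      | smul c x _ hx => rw [inner_smul_left, hx, mul_zero]
    · intro h
      ext t
      exact h (A t) (Submodule.subset_span ⟨t, rfl⟩)
  have hrank : Module.finrank ℝ T.range = k := by
    have h1 := T.finrank_range_add_finrank_ker
    have h2 := Submodule.finrank_add_finrank_orthogonal (Submodule.span ℝ (Set.range A))
    rw [hker] at h1
    omega
  let e := (stdOrthonormalBasis ℝ T.range).reindex (finCongr hrank)
  refine ⟨Matrix.of fun t i => (e i : EuclideanSpace ℝ (Fin n)) t, ?_, fun θ => ?_⟩
  · ext i j
    have h := orthonormal_iff_ite.1 e.orthonormal j i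
    rw [Submodule.coe_inner, PiLp.inner_apply] at h
    rw [Matrix.mul_apply, Matrix.one_apply]
    simpa [eq_comm] using h
  · refine ⟨fun i => e.repr ⟨T θ, θ, rfl⟩ i, fun t => ?_⟩
    have h := congrArg (fun x : T.range => (x : EuclideanSpace ℝ (Fin n)) t)
      (e.sum_repr ⟨T θ, θ, rfl⟩)
    have hT : T θ t = ⟪A t, θ⟫ := rfl
    simp only [Submodule.coe_sum, Submodule.coe_smul, WithLp.ofLp_sum, Finset.sum_apply,
      WithLp.ofLp_smul, Pi.smul_apply, smul_eq_mul, hT] at h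
    rw [← h]
    simp [Matrix.mulVec, dotProduct, mul_comm]

/-- **Expected error of the constrained least-squares estimator (Corollary 9(b) of the
paper).**  Let `A_1, …, A_n` be fixed vectors whose span has dimension `k`,
`η_1, …, η_n` i.i.d. standard Gaussians, `θ⋆ ∈ Θ ⊆ B^d_1`, rewards
`X_t = ⟪A_t, θ⋆⟫² + η_t`, and let `θ̂` (measurably) minimize
`L(θ) = (1/2) ∑_t (X_t − ⟪A_t, θ⟫²)²` over `Θ`.  Then
`E[∑_t ⟪A_t, θ̂ − θ⋆⟫² ⟪A_t, θ̂ + θ⋆⟫²] ≤ 9 (1 + k log(98 n))`. -/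
theorem least_squares_expected_error {d n : ℕ} {Ω : Type} [MeasurableSpace Ω]
    (μ : Measure Ω) [IsProbabilityMeasure μ]
    (η : Fin n → Ω → ℝ)
    (hη : Measure.map (fun ω => fun t => η t ω) μ =
      Measure.pi (fun _ : Fin n => gaussianReal 0 1))
    (A : Fin n → EuclideanSpace ℝ (Fin d)) (k : ℕ)
    (hk : Module.finrank ℝ (Submodule.span ℝ (Set.range A)) = k)
    (Θ : Set (EuclideanSpace ℝ (Fin d))) (hΘ : Θ ⊆ Metric.closedBall 0 1)
    (θstar : EuclideanSpace ℝ (Fin d)) (hθstar : θstar ∈ Θ)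
    (θhat : Ω → EuclideanSpace ℝ (Fin d)) (hθhat_meas : Measurable θhat)
    (hmem : ∀ ω, θhat ω ∈ Θ)
    (hmin : ∀ ω, ∀ θ ∈ Θ,
      (1 / 2) * ∑ t, (((⟪A t, θstar⟫) ^ 2 + η t ω) - (⟪A t, θhat ω⟫) ^ 2) ^ 2 ≤
        (1 / 2) * ∑ t, (((⟪A t, θstar⟫) ^ 2 + η t ω) - (⟪A t, θ⟫) ^ 2) ^ 2) :
    ∫ ω, ∑ t, (⟪A t, θhat ω - θstar⟫) ^ 2 * (⟪A t, θhat ω + θstar⟫) ^ 2 ∂μ ≤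
      9 * (1 + k * Real.log (98 * n)) := by
  have hterm (ω : Ω) (t : Fin n) :
      (⟪A t, θhat ω - θstar⟫) ^ 2 * (⟪A t, θhat ω + θstar⟫) ^ 2 =
        ((⟪A t, θhat ω⟫) ^ 2 - (⟪A t, θstar⟫) ^ 2) ^ 2 := by
    rw [inner_sub_right, inner_add_right]
    ring
  simp_rw [hterm]
  rcases Nat.eq_zero_or_pos k with rfl | hk0
  · have hA (t : Fin n) : A t = 0 := by
      rw [Submodule.finrank_eq_zero, Submodule.span_eq_bot] at hk
      exact hk _ ⟨t, rfl⟩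
    simp [hA]
  have hn : 0 < n := by
    rcases Nat.eq_zero_or_pos n with rfl | hn
    · rw [Set.range_eq_empty, Submodule.span_empty, finrank_bot] at hk
      omega
    · exact hn
  obtain ⟨a, ha, hcoord⟩ := exists_orthonormal_coordinates A k hk
  choose v hv using fun ω => hcoord (θhat ω)
  have hexcess (ω : Ω) (t : Fin n) : (⟪A t, θhat ω⟫) ^ 2 - (⟪A t, θstar⟫) ^ 2 =
      excess a (fun t => (⟪A t, θstar⟫) ^ 2) (v ω) t := by
    rw [excess, hv]
  simp_rw [hexcess]
  refine integral_sum_sq_excess_le hn hk0 μ (fun ω t => η t ω) hη a ha _ v fun ω => ?_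
  have h := le_of_mul_le_mul_left (hmin ω θstar hθstar) (by norm_num)
  have hexpand : ∑ t, (((⟪A t, θstar⟫) ^ 2 + η t ω) - (⟪A t, θhat ω⟫) ^ 2) ^ 2 =
      ∑ t, (((⟪A t, θstar⟫) ^ 2 + η t ω) - (⟪A t, θstar⟫) ^ 2) ^ 2 +
        (∑ t, excess a (fun t => (⟪A t, θstar⟫) ^ 2) (v ω) t ^ 2 -
          2 * ∑ t, excess a (fun t => (⟪A t, θstar⟫) ^ 2) (v ω) t * η t ω) := by
    rw [Finset.mul_sum, ← Finset.sum_sub_distrib, ← Finset.sum_add_distrib]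
    refine Finset.sum_congr rfl fun t _ => ?_
    rw [← hexcess]
    ring
  linarith
end

section
/- For any nonzero vectors θ, φ ∈ ℝ^d, ⟨θ/‖θ‖ − φ/‖φ‖, θ⟩ ≤ (2/‖θ‖)·‖θ − φ‖². -/
open scoped RealInnerProductSpace

/-- **Curvature lemma (Lemma 11 of the paper, after Kirschner–Lattimore–Krause).**
For any nonzero vectors `θ, φ ∈ ℝ^d`,
`⟪θ/‖θ‖ − φ/‖φ‖, θ⟫ ≤ (2/‖θ‖) · ‖θ − φ‖²`. -/
theorem curvature_lemma {d : ℕ} (θ φ : EuclideanSpace ℝ (Fin d)) (hθ : θ ≠ 0) (hφ : φ ≠ 0) :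
    ⟪‖θ‖⁻¹ • θ - ‖φ‖⁻¹ • φ, θ⟫ ≤ (2 / ‖θ‖) * ‖θ - φ‖ ^ 2 := by
  have ha : 0 < ‖θ‖ := norm_pos_iff.mpr hθ
  have hb : 0 < ‖φ‖ := norm_pos_iff.mpr hφ
  have hc := abs_le.mp (abs_real_inner_le_norm θ φ)
  rw [inner_sub_left, real_inner_smul_left, real_inner_smul_left, real_inner_self_eq_norm_sq,
    real_inner_comm θ φ, norm_sub_sq_real]
  obtain ⟨t, ht⟩ : ∃ t : ℝ, ⟪θ, φ⟫ = ‖θ‖ * ‖φ‖ * t :=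
    ⟨⟪θ, φ⟫ / (‖θ‖ * ‖φ‖), by field_simp⟩
  rw [ht] at hc ⊢
  generalize ‖θ‖ = a at *
  generalize ‖φ‖ = b at *
  have hab : 0 < a * b := mul_pos ha hb
  have ht_ge : -1 ≤ t := le_of_mul_le_mul_left (by linarith [hc.1]) hab
  have ht_le : t ≤ 1 := le_of_mul_le_mul_left (by linarith [hc.2]) hab
  have key : a ^ 2 * (1 - t) ≤ 2 * (a ^ 2 - 2 * (a * b * t) + b ^ 2) := by
    rcases le_total 0 t with h | h
    · have : 0 ≤ a ^ 2 * ((1 - t) * (1 + 2 * t)) :=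
        mul_nonneg (sq_nonneg a) (mul_nonneg (by linarith) (by linarith))
      nlinarith [sq_nonneg (b - a * t)]
    · nlinarith [mul_nonneg hab.le (neg_nonneg.mpr h),
        mul_nonneg (sq_nonneg a) (by linarith : 0 ≤ 1 + t), sq_nonneg b]
  calc a⁻¹ * a ^ 2 - b⁻¹ * (a * b * t) = a ^ 2 * (1 - t) / a := by field_simp
    _ ≤ 2 * (a ^ 2 - 2 * (a * b * t) + b ^ 2) / a := by gcongr
    _ = 2 / a * (a ^ 2 - 2 * (a * b * t) + b ^ 2) := by ring
end

section
/- For any nonzero vectors θ, φ ∈ ℝ^d, ⟨θ/‖θ‖, θ⟩² − ⟨φ/‖φ‖, θ⟩² ≤ 4·‖θ − φ‖²; equivalently, ‖θ‖² − ⟨φ/‖φ‖, θ⟩² ≤ 4·‖θ − φ‖². -/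
open scoped RealInnerProductSpace

/-- The squared distance from `x` to the line spanned by `y` is at most `‖x - y‖ ^ 2`. -/
theorem norm_sq_sub_inner_normalized_sq_le {E : Type*} [NormedAddCommGroup E]
    [InnerProductSpace ℝ E] (x : E) {y : E} (hy : y ≠ 0) :
    ‖x‖ ^ 2 - (⟪‖y‖⁻¹ • y, x⟫) ^ 2 ≤ ‖x - y‖ ^ 2 := by
  have hn : ‖y‖ ≠ 0 := norm_ne_zero_iff.mpr hy
  have hxy : ⟪x, y⟫ = ‖y‖ * ⟪‖y‖⁻¹ • y, x⟫ := by
    rw [real_inner_smul_left, real_inner_comm, mul_inv_cancel_left₀ hn]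
  rw [norm_sub_sq_real, hxy]
  nlinarith [sq_nonneg (‖y‖ - ⟪‖y‖⁻¹ • y, x⟫)]

/-- **Squared-inner-product curvature bound.**  For any nonzero vectors `θ, φ ∈ ℝ^d`,
`⟪θ/‖θ‖, θ⟫² − ⟪φ/‖φ‖, θ⟫² ≤ 4 ‖θ − φ‖²`; equivalently,
`‖θ‖² − ⟪φ/‖φ‖, θ⟫² ≤ 4 ‖θ − φ‖²`. -/
theorem squared_curvature_bound {d : ℕ} (θ φ : EuclideanSpace ℝ (Fin d))
    (hθ : θ ≠ 0) (hφ : φ ≠ 0) :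
    (⟪‖θ‖⁻¹ • θ, θ⟫) ^ 2 - (⟪‖φ‖⁻¹ • φ, θ⟫) ^ 2 ≤ 4 * ‖θ - φ‖ ^ 2 ∧
    ‖θ‖ ^ 2 - (⟪‖φ‖⁻¹ • φ, θ⟫) ^ 2 ≤ 4 * ‖θ - φ‖ ^ 2 := by
  have hline := norm_sq_sub_inner_normalized_sq_le θ hφ
  have hbound : ‖θ‖ ^ 2 - (⟪‖φ‖⁻¹ • φ, θ⟫) ^ 2 ≤ 4 * ‖θ - φ‖ ^ 2 := by
    linarith [sq_nonneg ‖θ - φ‖]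
  have hself : ⟪‖θ‖⁻¹ • θ, θ⟫ = ‖θ‖ := by
    rw [real_inner_smul_left, real_inner_self_eq_norm_sq, pow_two,
      inv_mul_cancel_left₀ (norm_ne_zero_iff.mpr hθ)]
  exact ⟨hself.symm ▸ hbound, hbound⟩
end

section
/- Let w_1, …, w_k ∈ ℝ^d be pairwise orthogonal nonzero vectors, let θ⋆ ∈ ℝ^d, let s ∈ {−1, +1}, and suppose s·⟨w_i, θ⋆⟩ ≥ ‖w_i‖²/2 for every i. Then, writing u = (Σ_i w_i)/‖Σ_i w_i‖, one has ⟨u, θ⋆⟩² ≥ (1/4)·Σ_{i=1}^k ‖w_i‖²; in particular, if moreover ‖w_i‖² ≥ τ² for all i, then |⟨u, θ⋆⟩| ≥ τ·√k/2. -/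
open scoped RealInnerProductSpace

/-- The Pythagorean theorem for a finite pairwise orthogonal family. -/
theorem norm_sq_sum_of_pairwise_orthogonal {E ι : Type*} [NormedAddCommGroup E]
    [InnerProductSpace ℝ E] [Fintype ι] (w : ι → E) (horth : ∀ i j, i ≠ j → ⟪w i, w j⟫ = 0) :
    ‖∑ i, w i‖ ^ 2 = ∑ i, ‖w i‖ ^ 2 := by
  rw [← real_inner_self_eq_norm_sq, sum_inner]
  refine Finset.sum_congr rfl fun i _ => ?_
  rw [inner_sum, Finset.sum_eq_single i (fun j _ hj => horth i j hj.symm) (by simp),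
    real_inner_self_eq_norm_sq]

/-- If orthogonal vectors all correlate with `θ` with the same sign, then their normalized sum
has correlation with `θ` at least half the norm of the sum. -/
theorem half_norm_sum_le_abs_inner {E ι : Type*} [NormedAddCommGroup E]
    [InnerProductSpace ℝ E] [Fintype ι] (w : ι → E) (horth : ∀ i j, i ≠ j → ⟪w i, w j⟫ = 0)
    (θ : E) (s : ℝ) (hs : |s| = 1) (hlb : ∀ i, ‖w i‖ ^ 2 / 2 ≤ s * ⟪w i, θ⟫) :
    ‖∑ i, w i‖ / 2 ≤ |⟪‖∑ i, w i‖⁻¹ • ∑ i, w i, θ⟫| := by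
  have hsum : ‖∑ i, w i‖ ^ 2 / 2 ≤ s * ⟪∑ i, w i, θ⟫ := by
    rw [norm_sq_sum_of_pairwise_orthogonal w horth, sum_inner, Finset.mul_sum, Finset.sum_div]
    exact Finset.sum_le_sum fun i _ => hlb i
  calc ‖∑ i, w i‖ / 2 = ‖∑ i, w i‖⁻¹ * (‖∑ i, w i‖ ^ 2 / 2) := by
        rcases eq_or_ne ‖∑ i, w i‖ 0 with h | h
        · simp [h]
        · field_simp
    _ ≤ ‖∑ i, w i‖⁻¹ * (s * ⟪∑ i, w i, θ⟫) := by gcongr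
    _ = s * ⟪‖∑ i, w i‖⁻¹ • ∑ i, w i, θ⟫ := by rw [real_inner_smul_left]; ring
    _ ≤ |s * ⟪‖∑ i, w i‖⁻¹ • ∑ i, w i, θ⟫| := le_abs_self _
    _ = |⟪‖∑ i, w i‖⁻¹ • ∑ i, w i, θ⟫| := by rw [abs_mul, hs, one_mul]

/-- **Aggregating orthogonal correlated directions (Step 1/Step 4 of Theorem 6 of the
paper).**  Let `w_1, …, w_k ∈ ℝ^d` be pairwise orthogonal nonzero vectors, `θ⋆ ∈ ℝ^d`,
`s ∈ {−1, +1}`, and suppose `s ⟪w_i, θ⋆⟫ ≥ ‖w_i‖²/2` for every `i`.  Then, with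
`u = (∑_i w_i)/‖∑_i w_i‖`, one has `⟪u, θ⋆⟫² ≥ (1/4) ∑_i ‖w_i‖²`; in particular, if
moreover `‖w_i‖² ≥ τ²` for all `i`, then `|⟪u, θ⋆⟫| ≥ τ √k / 2`. -/
theorem aggregate_orthogonal_directions {d k : ℕ} (w : Fin k → EuclideanSpace ℝ (Fin d))
    (hw0 : ∀ i, w i ≠ 0)
    (horth : ∀ i j, i ≠ j → ⟪w i, w j⟫ = 0)
    (θstar : EuclideanSpace ℝ (Fin d)) (s : ℝ) (hs : s = 1 ∨ s = -1)
    (hlb : ∀ i, ‖w i‖ ^ 2 / 2 ≤ s * ⟪w i, θstar⟫) :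
    (1 / 4) * ∑ i, ‖w i‖ ^ 2 ≤ (⟪‖∑ i, w i‖⁻¹ • ∑ i, w i, θstar⟫) ^ 2 ∧
    ∀ τ : ℝ, (∀ i, τ ^ 2 ≤ ‖w i‖ ^ 2) →
      τ * Real.sqrt k / 2 ≤ |⟪‖∑ i, w i‖⁻¹ • ∑ i, w i, θstar⟫| := by
  have habs : |s| = 1 := by rcases hs with rfl | rfl <;> simp
  have hnorm := norm_sq_sum_of_pairwise_orthogonal w horth
  have hmain := half_norm_sum_le_abs_inner w horth θstar s habs hlb
  refine ⟨?_, fun τ hτ => ?_⟩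
  · rw [← hnorm, ← sq_abs ⟪_, _⟫]
    calc 1 / 4 * ‖∑ i, w i‖ ^ 2 = (‖∑ i, w i‖ / 2) ^ 2 := by ring
      _ ≤ _ := by gcongr
  · have hle : τ * Real.sqrt k ≤ ‖∑ i, w i‖ := by
      refine le_trans (le_abs_self _) (abs_le_of_sq_le_sq ?_ (norm_nonneg _))
      rw [mul_pow, Real.sq_sqrt k.cast_nonneg, hnorm]
      simpa [mul_comm] using Finset.sum_le_sum fun i (_ : i ∈ Finset.univ) => hτ i
    linarith
end

section
/- Let d ≥ 8, r > 0, let σ denote the uniform probability measure on the sphere S^{d-1}_r in ℝ^d, and let a ∈ ℝ^d with ‖a‖ ≤ 1. Then σ({θ ∈ S^{d-1}_r : ⟨a, θ⟩² ≥ (3/4)·r²}) ≤ exp(−3d/16). -/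
open MeasureTheory
open scoped RealInnerProductSpace

/-- The part of the unit ball lying in the double cone of half-angle `π / 6` around a unit vector
is covered by two balls of radius `2 / 3`. -/
lemma cone_inter_ball_subset {E : Type*} [NormedAddCommGroup E] [InnerProductSpace ℝ E]
    (u : E) (hu : ‖u‖ = 1) :
    {x : E | 3 / 4 * ‖x‖ ^ 2 ≤ ⟪x, u⟫ ^ 2} ∩ Metric.ball 0 1 ⊆
      Metric.closedBall ((1 / 2 : ℝ) • u) (2 / 3) ∪
        Metric.closedBall (-((1 / 2 : ℝ) • u)) (2 / 3) := by
  rintro x ⟨hx, hx1⟩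
  simp only [Set.mem_ofPred_eq] at hx
  rw [mem_ball_zero_iff] at hx1
  have h0 := norm_nonneg x
  have key : 43 / 50 * ‖x‖ ≤ |⟪x, u⟫| := by
    refine (sq_le_sq₀ (by positivity) (abs_nonneg _)).1 ?_
    rw [sq_abs]
    nlinarith [sq_nonneg ‖x‖]
  have hs : ‖(1 / 2 : ℝ) • u‖ = 1 / 2 := by simp [norm_smul, hu]
  rw [Set.mem_union, mem_closedBall_iff_norm, mem_closedBall_iff_norm]
  rcases abs_cases ⟪x, u⟫ with ⟨h, -⟩ | ⟨h, -⟩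
  · left
    refine (sq_le_sq₀ (norm_nonneg _) (by norm_num)).1 ?_
    rw [norm_sub_sq_real, hs, real_inner_smul_right]
    nlinarith
  · right
    refine (sq_le_sq₀ (norm_nonneg _) (by norm_num)).1 ?_
    rw [sub_neg_eq_add, norm_add_sq_real, hs, real_inner_smul_right]
    nlinarith

lemma volume_cone_inter_ball_le {d : ℕ} (u : EuclideanSpace ℝ (Fin d)) (hu : ‖u‖ = 1) :
    volume ({x : EuclideanSpace ℝ (Fin d) | 3 / 4 * ‖x‖ ^ 2 ≤ ⟪x, u⟫ ^ 2} ∩ Metric.ball 0 1) ≤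
      ENNReal.ofReal (2 * (2 / 3) ^ d) *
        volume (Metric.ball (0 : EuclideanSpace ℝ (Fin d)) 1) := by
  refine (measure_mono (cone_inter_ball_subset u hu)).trans ((measure_union_le _ _).trans ?_)
  rw [Measure.addHaar_closedBall _ _ (by norm_num), Measure.addHaar_closedBall _ _ (by norm_num),
    finrank_euclideanSpace_fin, ← add_mul, ← ENNReal.ofReal_add (by positivity) (by positivity),
    ← two_mul]

lemma two_mul_two_thirds_pow_le_exp {d : ℕ} (hd : 8 ≤ d) :
    2 * (2 / 3 : ℝ) ^ d ≤ Real.exp (-(3 * (d : ℝ)) / 16) := by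
  have h : (13 / 16 : ℝ) ≤ Real.exp (-3 / 16) := by
    have := Real.add_one_le_exp (-3 / 16 : ℝ)
    linarith
  have he : Real.exp (-(3 * (d : ℝ)) / 16) = Real.exp (-3 / 16) ^ d := by
    rw [← Real.exp_nat_mul]
    ring_nf
  rw [he]
  clear he
  refine le_trans ?_ (pow_le_pow_left₀ (by norm_num) h d)
  induction d, hd using Nat.le_induction with
  | base => norm_num
  | succ n hn ih =>
    have : (0 : ℝ) ≤ (2 / 3) ^ n := by positivity
    rw [pow_succ, pow_succ]
    nlinarith

/-- A measure invariant under linear isometries gives equal mass to double cones of equal angle. -/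
lemma measure_double_cap_eq {E : Type*} [NormedAddCommGroup E] [InnerProductSpace ℝ E]
    [CompleteSpace E] [MeasurableSpace E] [BorelSpace E] (σ : Measure E)
    (hinv : ∀ L : E ≃ₗᵢ[ℝ] E, Measure.map (⇑L) σ = σ) {v w : E} (h : ‖v‖ = ‖w‖) (c : ℝ) :
    σ {θ | c ≤ ⟪v, θ⟫ ^ 2} = σ {θ | c ≤ ⟪w, θ⟫ ^ 2} := by
  set L := (ℝ ∙ (v - w))ᗮ.reflection
  have hL : L v = w := Submodule.reflection_sub h
  have hm : MeasurableSet {θ : E | c ≤ ⟪w, θ⟫ ^ 2} :=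
    (isClosed_le (by fun_prop) (by fun_prop)).measurableSet
  conv_rhs => rw [← hinv L]
  rw [Measure.map_apply L.continuous.measurable hm]
  congr 1
  ext θ
  simp only [Set.mem_ofPred_eq, Set.mem_preimage]
  rw [← hL, L.inner_map_map]

/-- Double caps of unit vectors, averaged against the volume of the unit ball. -/
lemma measure_double_cap_le {d : ℕ} {r : ℝ} (hr : 0 < r)
    (σ : Measure (EuclideanSpace ℝ (Fin d))) [IsProbabilityMeasure σ]
    (hsphere : σ (Metric.sphere 0 r) = 1)
    (hinv : ∀ L : EuclideanSpace ℝ (Fin d) ≃ₗᵢ[ℝ] EuclideanSpace ℝ (Fin d),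
      Measure.map (⇑L) σ = σ)
    (u : EuclideanSpace ℝ (Fin d)) (hu : ‖u‖ = 1) :
    σ {θ | 3 / 4 * r ^ 2 ≤ ⟪u, θ⟫ ^ 2} ≤ ENNReal.ofReal (2 * (2 / 3) ^ d) := by
  set B := Metric.ball (0 : EuclideanSpace ℝ (Fin d)) 1
  set μ := (volume : Measure (EuclideanSpace ℝ (Fin d))).restrict B
  have hB0 : volume B ≠ 0 := (Metric.measure_ball_pos volume _ one_pos).ne'
  have hB1 : volume B ≠ ⊤ := measure_ball_lt_top.ne
  have : IsFiniteMeasure μ := ⟨by simpa [μ] using hB1.lt_top⟩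
  set S := {p : EuclideanSpace ℝ (Fin d) × EuclideanSpace ℝ (Fin d) |
    3 / 4 * (‖p.1‖ ^ 2 * r ^ 2) ≤ ⟪p.1, p.2⟫ ^ 2}
  have hS : MeasurableSet S := (isClosed_le (by fun_prop) (by fun_prop)).measurableSet
  set M := σ {θ | 3 / 4 * r ^ 2 ≤ ⟪u, θ⟫ ^ 2}
  have hslice_ge (x : EuclideanSpace ℝ (Fin d)) : M ≤ σ (Prod.mk x ⁻¹' S) := by
    have hx : ‖‖x‖ • u‖ = ‖x‖ := by simp [norm_smul, hu]
    calc M ≤ σ {θ | 3 / 4 * (‖x‖ ^ 2 * r ^ 2) ≤ ⟪‖x‖ • u, θ⟫ ^ 2} := by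
          apply measure_mono
          intro θ hθ
          simp only [Set.mem_ofPred_eq] at hθ ⊢
          rw [real_inner_smul_left, mul_pow]
          nlinarith [mul_le_mul_of_nonneg_left hθ (sq_nonneg ‖x‖)]
      _ = σ (Prod.mk x ⁻¹' S) := measure_double_cap_eq σ hinv hx _
  have hslice_le (θ : EuclideanSpace ℝ (Fin d)) (hθ : θ ∈ Metric.sphere 0 r) :
      μ ((fun x ↦ (x, θ)) ⁻¹' S) ≤ ENNReal.ofReal (2 * (2 / 3) ^ d) * volume B := by
    rw [mem_sphere_zero_iff_norm] at hθ
    have hu' : ‖r⁻¹ • θ‖ = 1 := by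
      rw [norm_smul, hθ, Real.norm_of_nonneg (by positivity), inv_mul_cancel₀ hr.ne']
    rw [Measure.restrict_apply (measurable_prodMk_right hS)]
    refine (measure_mono (Set.inter_subset_inter_left _ ?_)).trans
      (volume_cone_inter_ball_le _ hu')
    intro x hx
    simp only [S, Set.mem_preimage, Set.mem_ofPred_eq] at hx ⊢
    rw [real_inner_smul_right, mul_pow, inv_pow, inv_mul_eq_div, le_div_iff₀ (by positivity)]
    linarith
  have hae : ∀ᵐ θ ∂σ, θ ∈ Metric.sphere (0 : EuclideanSpace ℝ (Fin d)) r :=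
    (mem_ae_iff_prob_eq_one Metric.isClosed_sphere.measurableSet).2 hsphere
  have key : M * volume B ≤ ENNReal.ofReal (2 * (2 / 3) ^ d) * volume B :=
    calc M * volume B = ∫⁻ _, M ∂μ := by simp [μ]
      _ ≤ ∫⁻ x, σ (Prod.mk x ⁻¹' S) ∂μ := lintegral_mono hslice_ge
      _ = (μ.prod σ) S := (Measure.prod_apply hS).symm
      _ = ∫⁻ θ, μ ((fun x ↦ (x, θ)) ⁻¹' S) ∂σ := Measure.prod_apply_symm hS
      _ ≤ ∫⁻ _, ENNReal.ofReal (2 * (2 / 3) ^ d) * volume B ∂σ :=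
          lintegral_mono_ae (hae.mono hslice_le)
      _ = ENNReal.ofReal (2 * (2 / 3) ^ d) * volume B := by simp
  exact (ENNReal.mul_le_mul_iff_left hB0 hB1).1 key

/-- **Concentration on the sphere (Step 1 in the proof of Theorem 4 of the paper).**
Let `d ≥ 8`, `r > 0`, let `σ` be the uniform probability measure on the sphere of radius
`r` in `ℝ^d` — i.e. a probability measure giving the sphere full mass and invariant
under every linear isometry — and let `a ∈ ℝ^d` with `‖a‖ ≤ 1`.  Then
`σ({θ ∈ S^{d-1}_r : ⟪a, θ⟫² ≥ (3/4) r²}) ≤ exp(−3d/16)`. -/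
theorem sphere_cap_measure_bound {d : ℕ} (hd : 8 ≤ d) (r : ℝ) (hr : 0 < r)
    (a : EuclideanSpace ℝ (Fin d)) (ha : ‖a‖ ≤ 1)
    (σ : Measure (EuclideanSpace ℝ (Fin d))) (hprob : IsProbabilityMeasure σ)
    (hsphere : σ (Metric.sphere 0 r) = 1)
    (hinv : ∀ L : EuclideanSpace ℝ (Fin d) ≃ₗᵢ[ℝ] EuclideanSpace ℝ (Fin d),
      Measure.map (⇑L) σ = σ) :
    σ {θ | θ ∈ Metric.sphere (0 : EuclideanSpace ℝ (Fin d)) r ∧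
        3 / 4 * r ^ 2 ≤ (⟪a, θ⟫) ^ 2}
      ≤ ENNReal.ofReal (Real.exp (-(3 * (d : ℝ)) / 16)) := by
  rcases eq_or_ne a 0 with rfl | ha0
  · have : {θ | θ ∈ Metric.sphere (0 : EuclideanSpace ℝ (Fin d)) r ∧
        3 / 4 * r ^ 2 ≤ (⟪(0 : EuclideanSpace ℝ (Fin d)), θ⟫) ^ 2} = ∅ := by
      ext θ
      simp [hr]
    rw [this, measure_empty]
    exact zero_le
  have hpos : 0 < ‖a‖ := norm_pos_iff.2 ha0
  have hu : ‖‖a‖⁻¹ • a‖ = 1 := by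
    rw [norm_smul, norm_inv, norm_norm, inv_mul_cancel₀ hpos.ne']
  refine le_trans (measure_mono ?_) ((measure_double_cap_le hr σ hsphere hinv _ hu).trans
    (ENNReal.ofReal_le_ofReal (two_mul_two_thirds_pow_le_exp hd)))
  rintro θ ⟨-, hθ⟩
  simp only [Set.mem_ofPred_eq]
  rw [real_inner_smul_left, mul_pow]
  refine hθ.trans (le_mul_of_one_le_left (sq_nonneg _) ?_)
  exact one_le_pow₀ ((one_le_inv₀ hpos).2 ha)
end
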